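/- Comparison principle under a Lipschitz side condition: let U ⊆ ℝ^d be open, let A satisfy (A1)–(A2), and suppose H is uniformly continuous on U × B_r for every r > 0. Let v be upper semicontinuous on [0,T]×cl(U) and a viscosity subsolution of ∂_t u − tr(A(x) D_x² u) + H(x, D_x u) = 0 in (0,T)×U, and let w be lower semicontinuous on [0,T]×cl(U) and a viscosity supersolution of the same equation; assume the sublinear growth condition holds, and that at least one of v, w is Lipschitz in the space variable uniformly in time (i.e. there exists κ ≥ 0 with |v(t,x)−v(t,y)| ≤ κ|x−y| for all t ∈ (0,T), x,y ∈ U, or the same for w). Then v(t,x) − w(t,x) ≤ sup_{∂_P((0,T)×U)} (v − w) for every (t,x) ∈ (0,T)×U. -/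

import Mathlib

open Set Metric Filter
open scoped ENNReal RealInnerProductSpace

noncomputable section

abbrev Euc (d : ℕ) := EuclideanSpace ℝ (Fin d)

/-- Time partial derivative `∂_t u (t,x)`. -/
def timeDeriv (d : ℕ) (u : ℝ × Euc d → ℝ) (t : ℝ) (x : Euc d) : ℝ :=
  deriv (fun s => u (s, x)) t

/-- Spatial partial derivative `∂_{x_i} u (t,x)`. -/
def spacePartial (d : ℕ) (i : Fin d) (u : ℝ × Euc d → ℝ) (t : ℝ) (x : Euc d) : ℝ :=
  fderiv ℝ (fun y => u (t, y)) x (EuclideanSpace.single i 1)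

/-- Spatial gradient `D_x u (t,x)`. -/
def spaceGrad (d : ℕ) (u : ℝ × Euc d → ℝ) (t : ℝ) (x : Euc d) : Euc d :=
  (EuclideanSpace.equiv (Fin d) ℝ).symm (fun i => spacePartial d i u t x)

/-- Spatial Hessian matrix `D_x² u (t,x)`. -/
def spaceHessian (d : ℕ) (u : ℝ × Euc d → ℝ) (t : ℝ) (x : Euc d) :
    Matrix (Fin d) (Fin d) ℝ :=
  Matrix.of fun i j => spacePartial d i (fun p => spacePartial d j u p.1 p.2) t x

/-- The quasilinear parabolic operator `∂_t u - tr(A(x) D_x² u) + H(x, D_x u)`. -/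
def parabolicOp (d : ℕ) (A : Euc d → Matrix (Fin d) (Fin d) ℝ) (H : Euc d → Euc d → ℝ)
    (u : ℝ × Euc d → ℝ) (t : ℝ) (x : Euc d) : ℝ :=
  timeDeriv d u t x - Matrix.trace (A x * spaceHessian d u t x) + H x (spaceGrad d u t x)

/-- Viscosity subsolution of `∂_t u - tr(A(x) D_x² u) + H(x, D_x u) = 0` in `(0,T) × U`. -/
def IsViscSubsolution (d : ℕ) (A : Euc d → Matrix (Fin d) (Fin d) ℝ)
    (H : Euc d → Euc d → ℝ) (T : ℝ) (U : Set (Euc d)) (v : ℝ × Euc d → ℝ) : Prop :=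
  ∀ φ : ℝ × Euc d → ℝ, ContDiff ℝ 2 φ → ∀ t₀ ∈ Ioo (0 : ℝ) T, ∀ x₀ ∈ U,
    IsLocalMaxOn (fun p => v p - φ p) (Ioo 0 T ×ˢ U) (t₀, x₀) →
    parabolicOp d A H φ t₀ x₀ ≤ 0

/-- Viscosity supersolution of `∂_t u - tr(A(x) D_x² u) + H(x, D_x u) = 0` in `(0,T) × U`. -/
def IsViscSupersolution (d : ℕ) (A : Euc d → Matrix (Fin d) (Fin d) ℝ)
    (H : Euc d → Euc d → ℝ) (T : ℝ) (U : Set (Euc d)) (w : ℝ × Euc d → ℝ) : Prop :=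
  ∀ φ : ℝ × Euc d → ℝ, ContDiff ℝ 2 φ → ∀ t₀ ∈ Ioo (0 : ℝ) T, ∀ x₀ ∈ U,
    IsLocalMinOn (fun p => w p - φ p) (Ioo 0 T ×ˢ U) (t₀, x₀) →
    0 ≤ parabolicOp d A H φ t₀ x₀

/-- Frobenius norm of a real matrix. -/
def matFrobNorm {k l : ℕ} (Mm : Matrix (Fin k) (Fin l) ℝ) : ℝ :=
  Real.sqrt (∑ i, ∑ j, (Mm i j) ^ 2)

/-- Conditions (A1)–(A2): `A = σ σᵀ` with `σ` bounded and Lipschitz with constant `Λ_A`. -/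
def CondA (d : ℕ) (ΛA : ℝ) (A : Euc d → Matrix (Fin d) (Fin d) ℝ) : Prop :=
  ∃ n : ℕ, ∃ σ : Euc d → Matrix (Fin d) (Fin n) ℝ,
    (∀ x, A x = σ x * (σ x).transpose) ∧
    (∀ x, matFrobNorm (σ x) ≤ ΛA) ∧
    (∀ x y, matFrobNorm (σ x - σ y) ≤ ΛA * ‖x - y‖)

/-- Condition (A3): entries of `A` are `C¹`. -/
def CondA3 (d : ℕ) (A : Euc d → Matrix (Fin d) (Fin d) ℝ) : Prop :=
  ∀ i j, ContDiff ℝ 1 (fun x : Euc d => A x i j)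

/-- Condition (A4): uniform ellipticity `⟨A(x)ξ, ξ⟩ ≥ λ|ξ|²`. -/
def CondA4 (d : ℕ) (lam : ℝ) (A : Euc d → Matrix (Fin d) (Fin d) ℝ) : Prop :=
  ∀ x ξ : Euc d, lam * ‖ξ‖ ^ 2 ≤ ∑ i, ∑ j, A x i j * ξ j * ξ i

/-- Condition (H3). -/
def CondH3 (d : ℕ) (m Λ : ℝ) (H : Euc d → Euc d → ℝ) : Prop :=
  ∀ x p q : Euc d, |H x p - H x q| ≤ Λ * (‖p‖ + ‖q‖ + 1) ^ (m - 1) * ‖p - q‖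

/-- Condition (H4) with parameter `μ`. -/
def CondH4 (d : ℕ) (m Λ μ : ℝ) (a M : ℝ → ℝ) (H : Euc d → Euc d → ℝ) : Prop :=
  ∀ r : ℝ, 0 < r →
    (a r ∈ Ioc (0 : ℝ) 1 ∧ 1 ≤ M r) ∧
    (∀ x ∈ ball (0 : Euc d) r, ∀ p : Euc d,
      max (-μ) (a r * ‖p‖ ^ m - M r) ≤ H x p ∧ H x p ≤ Λ * (‖p‖ ^ m + 1)) ∧
    (∀ x ∈ ball (0 : Euc d) r, ∀ y ∈ ball (0 : Euc d) r, ∀ p : Euc d,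
      |H x p - H y p| ≤ (Λ * ‖p‖ ^ m + M r) * ‖x - y‖)

/-- Condition (H4) with `μ = +∞`. -/
def CondH4top (d : ℕ) (m Λ : ℝ) (a M : ℝ → ℝ) (H : Euc d → Euc d → ℝ) : Prop :=
  ∀ r : ℝ, 0 < r →
    (a r ∈ Ioc (0 : ℝ) 1 ∧ 1 ≤ M r) ∧
    (∀ x ∈ ball (0 : Euc d) r, ∀ p : Euc d,
      a r * ‖p‖ ^ m - M r ≤ H x p ∧ H x p ≤ Λ * (‖p‖ ^ m + 1)) ∧
    (∀ x ∈ ball (0 : Euc d) r, ∀ y ∈ ball (0 : Euc d) r, ∀ p : Euc d,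
      |H x p - H y p| ≤ (Λ * ‖p‖ ^ m + M r) * ‖x - y‖)

/-- `limsup_{|x|→∞, x∈U} sup_{t∈[0,T]} v(t,x)/(1+|x|) ≤ 0`. -/
def SublinearAbove (d : ℕ) (T : ℝ) (U : Set (Euc d)) (v : ℝ × Euc d → ℝ) : Prop :=
  ∀ ε : ℝ, 0 < ε → ∃ R : ℝ, ∀ x ∈ U, R ≤ ‖x‖ → ∀ t ∈ Icc (0 : ℝ) T, v (t, x) ≤ ε * (1 + ‖x‖)

/-- `liminf_{|x|→∞, x∈U} inf_{t∈[0,T]} w(t,x)/(1+|x|) ≥ 0`. -/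
def SublinearBelow (d : ℕ) (T : ℝ) (U : Set (Euc d)) (w : ℝ × Euc d → ℝ) : Prop :=
  ∀ ε : ℝ, 0 < ε → ∃ R : ℝ, ∀ x ∈ U, R ≤ ‖x‖ → ∀ t ∈ Icc (0 : ℝ) T, -(ε * (1 + ‖x‖)) ≤ w (t, x)

/-- Parabolic boundary `({0} × U) ∪ ([0,T) × ∂U)`. -/
def parabolicBoundary (d : ℕ) (T : ℝ) (U : Set (Euc d)) : Set (ℝ × Euc d) :=
  ({0} ×ˢ U) ∪ (Ico 0 T ×ˢ frontier U)

section JA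

open MeasureTheory

variable {Z : Type*} [NormedAddCommGroup Z] [InnerProductSpace ℝ Z]

lemma ja_norm_le (a : Z) (c r : ℝ) (hc : 0 ≤ c) (hr : 0 ≤ r)
    (h : ∀ x : Z, inner ℝ a x ≤ c * (‖x‖ + r) ^ 2) : ‖a‖ ≤ 4 * c * r := by
  by_cases ha : a = 0
  · subst ha; simp; positivity
  have hna : 0 < ‖a‖ := norm_pos_iff.mpr ha
  have key : ∀ e : ℝ, 0 < e → ‖a‖ ≤ 4 * c * (r + e) := by
    intro e he
    have h1 := h (((r + e) / ‖a‖) • a)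
    rw [inner_smul_right, real_inner_self_eq_norm_sq, norm_smul, Real.norm_eq_abs,
      abs_of_nonneg (by positivity)] at h1
    have h2 : (r + e) / ‖a‖ * ‖a‖ ^ 2 = (r + e) * ‖a‖ := by field_simp
    have h3 : (r + e) / ‖a‖ * ‖a‖ = r + e := by field_simp
    rw [h2, h3] at h1
    have h4 : c * (r + e + r) ^ 2 ≤ c * (4 * (r + e) ^ 2) := by
      apply mul_le_mul_of_nonneg_left _ hc
      nlinarith
    have h5 : (r + e) * ‖a‖ ≤ (r + e) * (4 * c * (r + e)) := by nlinarith
    exact le_of_mul_le_mul_left h5 (by positivity)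
  apply le_of_forall_pos_le_add
  intro e he
  have := key (e / (4 * c + 1)) (by positivity)
  have h6 : 4 * c * (e / (4 * c + 1)) ≤ e := by
    rw [← mul_div_assoc, div_le_iff₀ (by positivity)]; nlinarith
  linarith

lemma ja_antitone (ψ : ℝ → ℝ) (C : ℝ)
    (h : ∀ a b : ℝ, 0 ≤ a → a ≤ b → b ≤ 1 → ψ b - ψ a ≤ C * (b - a) ^ 2) : ψ 1 ≤ ψ 0 := by
  have key : ∀ N : ℕ, ψ 1 - ψ 0 ≤ C / (N + 1) := by
    intro N
    have hN : (0 : ℝ) < N + 1 := by positivity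
    have ind : ∀ k : ℕ, k ≤ N + 1 →
        ψ ((k : ℝ) / (N + 1)) - ψ 0 ≤ k * (C * (1 / ((N : ℝ) + 1)) ^ 2) := by
      intro k
      induction k with
      | zero => intro _; simp
      | succ k ih =>
        intro hk
        have h1 := ih (by omega)
        have hk' : (k : ℝ) + 1 ≤ N + 1 := by exact_mod_cast hk
        have h2 := h ((k : ℝ) / (N + 1)) (((k : ℝ) + 1) / (N + 1)) (by positivity)
          (by gcongr; linarith) (by rw [div_le_one hN]; exact hk')
        have h3 : ((k : ℝ) + 1) / (N + 1) - (k : ℝ) / (N + 1) = 1 / ((N : ℝ) + 1) := by ring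
        rw [h3] at h2
        push_cast
        linarith
    have h1 := ind (N + 1) le_rfl
    push_cast at h1
    rw [div_self hN.ne'] at h1
    have h2 : ((N : ℝ) + 1) * (C * (1 / ((N : ℝ) + 1)) ^ 2) = C / (N + 1) := by field_simp
    linarith
  have hlim : Tendsto (fun N : ℕ => C / ((N : ℝ) + 1)) atTop (nhds 0) := by
    have := (tendsto_one_div_add_atTop_nhds_zero_nat (𝕜 := ℝ)).const_mul C
    simpa [div_eq_mul_inv] using this
  have := ge_of_tendsto' hlim key
  linarith

lemma ja_chain (γ m : ℝ → ℝ) (a b e : ℝ)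
    (hγ : ∀ τ τ' : ℝ, γ τ + m τ * (τ' - τ) ≤ γ τ')
    (hm : ∀ τ : ℝ, 0 ≤ τ → τ ≤ 1 → |m τ - a - b * τ| ≤ e) :
    |γ 1 - γ 0 - a - b / 2| ≤ e := by
  rw [abs_le]
  constructor
  · have := ja_antitone (fun τ => -(γ τ) + a * τ + b * τ ^ 2 / 2 - e * τ) (b / 2) (by
      intro x y hx hxy hy
      have h1 := hγ x y
      have h2 := (abs_le.mp (hm x hx (by linarith))).1
      have h3 : (a + b * x - e) * (y - x) ≤ m x * (y - x) :=
        mul_le_mul_of_nonneg_right (by linarith) (by linarith)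
      nlinarith)
    norm_num at this
    linarith
  · have := ja_antitone (fun τ => γ τ - a * τ - b * τ ^ 2 / 2 - e * τ) (b / 2) (by
      intro x y hx hxy hy
      have h1 := hγ y x
      have h2 := (abs_le.mp (hm y (by linarith) hy)).2
      have h3 : m y * (y - x) ≤ (a + b * y + e) * (y - x) :=
        mul_le_mul_of_nonneg_right (by linarith) (by linarith)
      nlinarith)
    norm_num at this
    linarith

/-- second-order expansion from first order expansion of the subgradients -/
lemma ja_expand (g : Z → ℝ) (s : Z → Z) (hs : ∀ z z', g z + inner ℝ (s z) (z' - z) ≤ g z')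
    (z : Z) (S : Z →L[ℝ] Z)
    (h : ∀ η : ℝ, 0 < η → ∃ δ : ℝ, 0 < δ ∧ ∀ x : Z, ‖x‖ < δ → ‖s (z + x) - s z - S x‖ ≤ η * ‖x‖) :
    ∀ η : ℝ, 0 < η → ∃ δ : ℝ, 0 < δ ∧ ∀ x : Z, ‖x‖ < δ →
      |g (z + x) - g z - inner ℝ (s z) x - inner ℝ (S x) x / 2| ≤ η * ‖x‖ ^ 2 := by
  intro η hη
  obtain ⟨δ, hδ, hd⟩ := h η hη
  refine ⟨δ, hδ, fun x hx => ?_⟩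
  have := ja_chain (fun τ => g (z + τ • x)) (fun τ => inner ℝ (s (z + τ • x)) x)
    (inner ℝ (s z) x) (inner ℝ (S x) x) (η * ‖x‖ ^ 2) (by
      intro τ τ'
      have := hs (z + τ • x) (z + τ' • x)
      have e : z + τ' • x - (z + τ • x) = (τ' - τ) • x := by module
      rw [e, inner_smul_right] at this
      linarith) (by
      intro τ h0 h1
      have hn : ‖τ • x‖ ≤ ‖x‖ := by
        rw [norm_smul, Real.norm_eq_abs, abs_of_nonneg h0]
        nlinarith [norm_nonneg x]
      have h2 := hd (τ • x) (lt_of_le_of_lt hn hx)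
      have e : inner ℝ (s (z + τ • x)) x - inner ℝ (s z) x - inner ℝ (S x) x * τ
          = inner ℝ (s (z + τ • x) - s z - S (τ • x)) x := by
        rw [inner_sub_left, inner_sub_left, map_smul, inner_smul_left]
        simp; ring
      rw [e]
      calc |inner ℝ (s (z + τ • x) - s z - S (τ • x)) x|
          ≤ ‖s (z + τ • x) - s z - S (τ • x)‖ * ‖x‖ := abs_real_inner_le_norm _ _
        _ ≤ (η * ‖τ • x‖) * ‖x‖ := by gcongr
        _ ≤ (η * ‖x‖) * ‖x‖ := by gcongr
        _ = η * ‖x‖ ^ 2 := by ring)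
  simpa using this

variable [FiniteDimensional ℝ Z]

/-- Alexandrov-type theorem on contact sets. -/
lemma ja_alex (s : Z → Z) (hmono : ∀ z z', 0 ≤ inner ℝ (s z - s z') (z - z')) (c : ℝ) (hc : 0 ≤ c)
    (K : Set Z)
    (hK : ∀ z ∈ K, ∀ z', ‖s z' - s z‖ ≤ c * ‖z' - z‖)
    (B : Z →L[ℝ] Z) (ρ : ℝ) (hρ : 0 < ρ) (hball : Metric.ball (0 : Z) ρ ⊆ (fun z => s z - B z) '' K) :
    ∃ z ∈ K, ∃ S : Z →L[ℝ] Z, ∀ η : ℝ, 0 < η → ∃ δ : ℝ, 0 < δ ∧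
      ∀ x : Z, ‖x‖ < δ → ‖s (z + x) - s z - S x‖ ≤ η * ‖x‖ := by
  borelize Z
  set μ : Measure Z := Measure.hausdorffMeasure (Module.finrank ℝ Z : ℝ) with hμ
  have hHaar : μ.IsAddHaarMeasure := by rw [hμ]; infer_instance
  -- K has positive measure
  have hLipK : LipschitzOnWith (Real.toNNReal (c + ‖B‖)) (fun z => s z - B z) K := by
    apply LipschitzOnWith.of_dist_le_mul
    intro x hx y hy
    rw [dist_eq_norm, dist_eq_norm, Real.coe_toNNReal _ (by positivity)]
    have h1 := hK y hy x
    have h2 : ‖B (x - y)‖ ≤ ‖B‖ * ‖x - y‖ := B.le_opNorm _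
    calc ‖s x - B x - (s y - B y)‖ = ‖(s x - s y) - B (x - y)‖ := by
            rw [map_sub]; congr 1; abel
      _ ≤ ‖s x - s y‖ + ‖B (x - y)‖ := norm_sub_le _ _
      _ ≤ _ := by linarith
  have hKpos : μ K ≠ 0 := by
    intro h0
    have h1 := hLipK.hausdorffMeasure_image_le (d := (Module.finrank ℝ Z : ℝ)) (by positivity)
    rw [← hμ, h0, mul_zero] at h1
    have h2 : 0 < μ (Metric.ball (0 : Z) ρ) := Metric.measure_ball_pos μ _ hρ
    have h3 := measure_mono (μ := μ) hball
    exact absurd (h2.trans_le (h3.trans h1)) (lt_irrefl _)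
  -- the resolvent
  let y : Z → Z := fun z => z + s z
  have hy : ∀ a b, ‖a - b‖ ≤ ‖y a - y b‖ := by
    intro a b
    have h1 := hmono a b
    have h2 : ‖a - b‖ ^ 2 ≤ inner ℝ (y a - y b) (a - b) := by
      have : y a - y b = (a - b) + (s a - s b) := by simp only [y]; abel
      rw [this, inner_add_left, real_inner_self_eq_norm_sq]; linarith
    have h3 := real_inner_le_norm (y a - y b) (a - b)
    by_cases h : ‖a - b‖ = 0
    · rw [h]; positivity
    · have : 0 < ‖a - b‖ := lt_of_le_of_ne (norm_nonneg _) (Ne.symm h)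
      nlinarith
  have hinj : Function.Injective y := by
    intro a b hab
    have := hy a b
    rw [hab, sub_self, norm_zero] at this
    exact sub_eq_zero.mp (norm_le_zero_iff.mp this)
  have hinv : ∀ z, Function.invFun y (y z) = z := Function.leftInverse_invFun hinj
  have hLipJ : LipschitzOnWith 1 (Function.invFun y) (Set.range y) := by
    apply LipschitzOnWith.of_dist_le_mul
    rintro _ ⟨a, rfl⟩ _ ⟨b, rfl⟩
    rw [hinv, hinv, dist_eq_norm, dist_eq_norm]
    simpa using hy a b
  obtain ⟨J, hJ, hJe⟩ := hLipJ.extend_finite_dimension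
  have hJy : ∀ z, J (y z) = z := fun z => by rw [← hJe ⟨z, rfl⟩, hinv]
  -- null sets
  let N1 : Set Z := {x | ¬ DifferentiableAt ℝ J x}
  let N2 : Set Z := {x | DifferentiableAt ℝ J x ∧ (fderiv ℝ J x).det = 0}
  have hN1 : μ N1 = 0 := by
    have := hJ.ae_differentiableAt (μ := μ)
    rwa [ae_iff] at this
  have hN1' : μ (J '' N1) = 0 := by
    have h1 := (hJ.lipschitzOnWith (s := N1)).hausdorffMeasure_image_le
      (d := (Module.finrank ℝ Z : ℝ)) (by positivity)
    rw [← hμ, hN1, mul_zero] at h1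
    exact le_antisymm h1 zero_le
  have hN2' : μ (J '' N2) = 0 :=
    addHaar_image_eq_zero_of_det_fderivWithin_eq_zero μ
      (fun x hx => hx.1.hasFDerivAt.hasFDerivWithinAt) (fun x hx => hx.2)
  obtain ⟨z, hzK, hz⟩ : ∃ z ∈ K, z ∉ J '' N1 ∪ J '' N2 := by
    by_contra hcon
    push Not at hcon
    exact hKpos (measure_mono_null hcon (measure_union_null hN1' hN2'))
  have hd1 : DifferentiableAt ℝ J (y z) := by
    by_contra h
    exact hz (Or.inl ⟨y z, h, hJy z⟩)
  have hd2 : (fderiv ℝ J (y z)).det ≠ 0 := by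
    intro h
    exact hz (Or.inr ⟨y z, ⟨hd1, h⟩, hJy z⟩)
  let Le := ContinuousLinearMap.toContinuousLinearEquivOfDetNeZero _ hd2
  have hLe : ∀ x, Le x = fderiv ℝ J (y z) x := fun x => rfl
  let Li : Z →L[ℝ] Z := (Le.symm : Z →L[ℝ] Z)
  refine ⟨z, hzK, Li - ContinuousLinearMap.id ℝ Z, ?_⟩
  intro η hη
  have hder := hd1.hasFDerivAt.isLittleO
  set e : ℝ := η / ((‖Li‖ + 1) * (1 + c)) with he
  have hepos : 0 < e := by positivity
  have h1 := (Asymptotics.isLittleO_iff.mp hder) hepos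
  rw [Metric.eventually_nhds_iff] at h1
  obtain ⟨δ, hδ, h1⟩ := h1
  refine ⟨δ / (1 + c), by positivity, fun x hx => ?_⟩
  have hyx : ‖y (z + x) - y z‖ ≤ (1 + c) * ‖x‖ := by
    have h2 := hK z hzK (z + x)
    rw [add_sub_cancel_left] at h2
    calc ‖y (z + x) - y z‖ = ‖x + (s (z + x) - s z)‖ := by simp only [y]; congr 1; abel
      _ ≤ ‖x‖ + ‖s (z + x) - s z‖ := norm_add_le _ _
      _ ≤ _ := by linarith
  have hlt : dist (y (z + x)) (y z) < δ := by
    rw [dist_eq_norm]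
    rw [lt_div_iff₀ (by positivity)] at hx
    linarith
  have h3 := h1 hlt
  rw [hJy, hJy, add_sub_cancel_left, ← hLe] at h3
  have h4 : s (z + x) - s z - (Li - ContinuousLinearMap.id ℝ Z) x
      = -Li (x - Le (y (z + x) - y z)) := by
    have : Li (Le (y (z + x) - y z)) = y (z + x) - y z := Le.symm_apply_apply _
    rw [map_sub, this]
    simp only [y, sub_apply, ContinuousLinearMap.id_apply]
    abel
  rw [h4, norm_neg]
  calc ‖Li (x - Le (y (z + x) - y z))‖ ≤ ‖Li‖ * ‖x - Le (y (z + x) - y z)‖ := Li.le_opNorm _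
    _ ≤ (‖Li‖ + 1) * (e * ((1 + c) * ‖x‖)) := by
        apply mul_le_mul (by linarith) (h3.trans (by gcongr)) (norm_nonneg _) (by positivity)
    _ = η * ‖x‖ := by rw [he]; field_simp

theorem ja_main (g : Z → ℝ) (s : Z → Z) (hs : ∀ z z', g z + inner ℝ (s z) (z' - z) ≤ g z')
    (B : Z →L[ℝ] Z) (hB : ∀ a b, inner ℝ (B a) b = inner ℝ a (B b)) (ρ : ℝ) (hρ : 0 < ρ)
    (hmax : ∀ p : Z, ‖p‖ < ρ → ∃ z, ∀ z', g z' - inner ℝ (B z') z' / 2 - inner ℝ p z'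
        ≤ g z - inner ℝ (B z) z / 2 - inner ℝ p z) :
    ∃ (z p : Z) (S : Z →L[ℝ] Z), ‖p‖ < ρ ∧
      (∀ z', g z' - inner ℝ (B z') z' / 2 - inner ℝ p z'
        ≤ g z - inner ℝ (B z) z / 2 - inner ℝ p z) ∧ s z = B z + p ∧
      (∀ η : ℝ, 0 < η → ∃ δ : ℝ, 0 < δ ∧ ∀ x : Z, ‖x‖ < δ →
        |g (z + x) - g z - inner ℝ (s z) x - inner ℝ (S x) x / 2| ≤ η * ‖x‖ ^ 2) ∧
      ∀ x, inner ℝ (S x) x ≤ inner ℝ (B x) x := by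
  set c : ℝ := ‖B‖ with hc
  have hc0 : 0 ≤ c := norm_nonneg _
  have up : ∀ p z : Z, (∀ z', g z' - inner ℝ (B z') z' / 2 - inner ℝ p z'
        ≤ g z - inner ℝ (B z) z / 2 - inner ℝ p z) →
      ∀ x, g (z + x) ≤ g z + inner ℝ (B z + p) x + inner ℝ (B x) x / 2 := by
    intro p z h x
    have h1 := h (z + x)
    have h2 : inner ℝ (B x) z = inner ℝ (B z) x := by rw [hB, real_inner_comm]
    simp only [map_add, inner_add_left, inner_add_right] at h1 ⊢
    linarith
  have hBx : ∀ x, inner ℝ (B x) x / 2 ≤ c * ‖x‖ ^ 2 := by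
    intro x
    have h1 := real_inner_le_norm (B x) x
    have h2 := B.le_opNorm x
    have h3 : ‖B x‖ * ‖x‖ ≤ c * ‖x‖ * ‖x‖ := mul_le_mul_of_nonneg_right h2 (norm_nonneg _)
    nlinarith [mul_nonneg hc0 (sq_nonneg ‖x‖)]
  let K : Set Z := {z | ∃ p : Z, ‖p‖ < ρ ∧ ∀ z', g z' - inner ℝ (B z') z' / 2 - inner ℝ p z'
        ≤ g z - inner ℝ (B z) z / 2 - inner ℝ p z}
  have hsK : ∀ p z : Z, (∀ z', g z' - inner ℝ (B z') z' / 2 - inner ℝ p z'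
        ≤ g z - inner ℝ (B z) z / 2 - inner ℝ p z) → s z = B z + p := by
    intro p z h
    have : ‖s z - (B z + p)‖ ≤ 4 * c * 0 := by
      apply ja_norm_le _ _ _ hc0 le_rfl
      intro x
      have h1 := hs z (z + x)
      have h2 := up p z h x
      have h3 := hBx x
      rw [add_sub_cancel_left] at h1
      rw [inner_sub_left, add_zero]
      linarith
    rw [mul_zero] at this
    exact sub_eq_zero.mp (norm_le_zero_iff.mp this)
  have hKs : ∀ z ∈ K, ∀ z', ‖s z' - s z‖ ≤ 4 * c * ‖z' - z‖ := by
    rintro z ⟨p, hp, h⟩ z'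
    apply ja_norm_le _ _ _ hc0 (norm_nonneg _)
    intro x
    have h1 := hs z' (z' + x)
    have h2 := hs z z'
    have h3 := up p z h (z' - z + x)
    have h4 := hBx (z' - z + x)
    have e1 : z + (z' - z + x) = z' + x := by abel
    rw [e1, ← hsK p z h, inner_add_right] at h3
    rw [add_sub_cancel_left] at h1
    have h5 : c * ‖z' - z + x‖ ^ 2 ≤ c * (‖x‖ + ‖z' - z‖) ^ 2 := by
      have := norm_add_le (z' - z) x
      gcongr
      linarith
    rw [inner_sub_left]
    linarith
  have hmono : ∀ z z', 0 ≤ inner ℝ (s z - s z') (z - z') := by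
    intro z z'
    have h1 := hs z z'
    have h2 := hs z' z
    have e : z' - z = -(z - z') := by abel
    rw [e, inner_neg_right] at h1
    rw [inner_sub_left]
    linarith
  obtain ⟨z, ⟨p, hp, hz⟩, S, hS⟩ := ja_alex s hmono (4 * c) (by positivity) K hKs B ρ hρ (by
    intro p hp
    rw [mem_ball_zero_iff] at hp
    obtain ⟨z, hz⟩ := hmax p hp
    exact ⟨z, ⟨p, hp, hz⟩, by simp only [hsK p z hz, add_sub_cancel_left]⟩)
  have hexp := ja_expand g s hs z S hS
  refine ⟨z, p, S, hp, hz, hsK p z hz, hexp, ?_⟩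
  intro x
  apply le_of_forall_pos_le_add
  intro e he
  obtain ⟨δ, hδ, hd⟩ := hexp (e / (2 * (‖x‖ ^ 2 + 1))) (by positivity)
  set t : ℝ := δ / (2 * (‖x‖ + 1)) with ht
  have htpos : 0 < t := by positivity
  have htx : ‖t • x‖ < δ := by
    rw [norm_smul, Real.norm_eq_abs, abs_of_pos htpos, ht, div_mul_eq_mul_div,
      div_lt_iff₀ (by positivity)]
    nlinarith [norm_nonneg x]
  have h1 := (abs_le.mp (hd (t • x) htx)).1
  have h2 := up p z hz (t • x)
  rw [← hsK p z hz] at h2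
  simp only [map_smul, inner_smul_left, inner_smul_right, norm_smul, Real.norm_eq_abs,
    abs_of_pos htpos, conj_trivial] at h1 h2
  have h3 : e / (2 * (‖x‖ ^ 2 + 1)) * (t * ‖x‖) ^ 2 ≤ t ^ 2 * (e / 2) := by
    have : e / (2 * (‖x‖ ^ 2 + 1)) * (t * ‖x‖) ^ 2
        = t ^ 2 * (e / 2) * (‖x‖ ^ 2 / (‖x‖ ^ 2 + 1)) := by field_simp
    rw [this]
    apply mul_le_of_le_one_right (by positivity)
    rw [div_le_one (by positivity)]; linarith
  have h4 : t ^ 2 * inner ℝ (S x) x ≤ t ^ 2 * (inner ℝ (B x) x + e) := by nlinarith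
  exact le_of_mul_le_mul_left h4 (by positivity)

end JA

section TS

variable {E : Type*} [NormedAddCommGroup E] [InnerProductSpace ℝ E]

def tsPsi (g1 g2 : E → ℝ) (p q x y : E) : ℝ :=
  g1 x + g2 y - (‖x‖ ^ 2 + ‖y‖ ^ 2) / 2 - ‖x - y‖ ^ 2 / 4 - inner ℝ p x - inner ℝ q y

def tsB [FiniteDimensional ℝ E] : WithLp 2 (E × E) →L[ℝ] WithLp 2 (E × E) :=
  LinearMap.toContinuousLinearMap
    { toFun := fun z => WithLp.toLp 2 ((3 / 2 : ℝ) • z.fst - (1 / 2 : ℝ) • z.snd,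
        (3 / 2 : ℝ) • z.snd - (1 / 2 : ℝ) • z.fst)
      map_add' := fun a b => by
        apply WithLp.ofLp_injective
        ext <;> simp <;> module
      map_smul' := fun c a => by
        apply WithLp.ofLp_injective
        ext <;> simp <;> module }

lemma tsB_fst [FiniteDimensional ℝ E] (z : WithLp 2 (E × E)) :
    (tsB z).fst = (3 / 2 : ℝ) • z.fst - (1 / 2 : ℝ) • z.snd := rfl

lemma tsB_snd [FiniteDimensional ℝ E] (z : WithLp 2 (E × E)) :
    (tsB z).snd = (3 / 2 : ℝ) • z.snd - (1 / 2 : ℝ) • z.fst := rfl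

lemma ts_fst (a b : E) : (WithLp.toLp 2 (a, b) : WithLp 2 (E × E)).fst = a := rfl

lemma ts_snd (a b : E) : (WithLp.toLp 2 (a, b) : WithLp 2 (E × E)).snd = b := rfl

lemma ts_inner (a b : WithLp 2 (E × E)) :
    inner ℝ a b = inner ℝ a.fst b.fst + inner ℝ a.snd b.snd := WithLp.prod_inner_apply a b

lemma ts_quad (x y : E) : inner ℝ ((3 / 2 : ℝ) • x - (1 / 2 : ℝ) • y) x
      + inner ℝ ((3 / 2 : ℝ) • y - (1 / 2 : ℝ) • x) y
      = ‖x‖ ^ 2 + ‖y‖ ^ 2 + ‖x - y‖ ^ 2 / 2 := by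
  rw [norm_sub_sq_real]
  simp only [inner_sub_left, inner_smul_left, real_inner_self_eq_norm_sq, conj_trivial,
    real_inner_comm x y]
  ring

variable [FiniteDimensional ℝ E]

lemma ts_core (g1 g2 : E → ℝ) (s1 s2 : E → E)
    (hs1 : ∀ z z', g1 z + inner ℝ (s1 z) (z' - z) ≤ g1 z')
    (hs2 : ∀ z z', g2 z + inner ℝ (s2 z) (z' - z) ≤ g2 z') (ρ : ℝ) (hρ : 0 < ρ)
    (hmax : ∀ p q : E, ‖p‖ < ρ → ‖q‖ < ρ → ∃ x y, ∀ x2 y2,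
      tsPsi g1 g2 p q x2 y2 ≤ tsPsi g1 g2 p q x y) :
    ∃ (x y p q : E) (X Y : E →L[ℝ] E), ‖p‖ < ρ ∧ ‖q‖ < ρ ∧
      (∀ x2 y2, tsPsi g1 g2 p q x2 y2 ≤ tsPsi g1 g2 p q x y) ∧
      s1 x = (3 / 2 : ℝ) • x - (1 / 2 : ℝ) • y + p ∧
      s2 y = (3 / 2 : ℝ) • y - (1 / 2 : ℝ) • x + q ∧
      (∀ η : ℝ, 0 < η → ∃ δ : ℝ, 0 < δ ∧ ∀ h : E, ‖h‖ < δ →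
        |g1 (x + h) - g1 x - inner ℝ (s1 x) h - inner ℝ (X h) h / 2| ≤ η * ‖h‖ ^ 2) ∧
      (∀ η : ℝ, 0 < η → ∃ δ : ℝ, 0 < δ ∧ ∀ h : E, ‖h‖ < δ →
        |g2 (y + h) - g2 y - inner ℝ (s2 y) h - inner ℝ (Y h) h / 2| ≤ η * ‖h‖ ^ 2) ∧
      ∀ a b, inner ℝ (X a) a + inner ℝ (Y b) b ≤ ‖a‖ ^ 2 + ‖b‖ ^ 2 + ‖a - b‖ ^ 2 / 2 := by
  have hnf : ∀ z : WithLp 2 (E × E), ‖z.fst‖ ≤ ‖z‖ := fun z => by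
    have := WithLp.prod_norm_sq_eq_of_L2 z
    apply le_of_sq_le_sq _ (norm_nonneg _)
    nlinarith [sq_nonneg ‖z.snd‖]
  have hns : ∀ z : WithLp 2 (E × E), ‖z.snd‖ ≤ ‖z‖ := fun z => by
    have := WithLp.prod_norm_sq_eq_of_L2 z
    apply le_of_sq_le_sq _ (norm_nonneg _)
    nlinarith [sq_nonneg ‖z.fst‖]
  have hΨ : ∀ p z : WithLp 2 (E × E),
      (g1 z.fst + g2 z.snd) - inner ℝ (tsB z) z / 2 - inner ℝ p z
        = tsPsi g1 g2 p.fst p.snd z.fst z.snd := by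
    intro p z
    rw [ts_inner, ts_inner, tsB_fst, tsB_snd, ts_quad, tsPsi]
    ring
  obtain ⟨z, p, S, hp, hz, hsz, hexp, hS⟩ := ja_main (Z := WithLp 2 (E × E))
    (fun z => g1 z.fst + g2 z.snd) (fun z => WithLp.toLp 2 (s1 z.fst, s2 z.snd))
    (by
      intro z z'
      have h1 := hs1 z.fst z'.fst
      have h2 := hs2 z.snd z'.snd
      rw [ts_inner]
      simp only [WithLp.sub_fst, WithLp.sub_snd, ts_fst, ts_snd]
      linarith) tsB
    (by
      intro a b
      rw [ts_inner, ts_inner, tsB_fst, tsB_snd, tsB_fst, tsB_snd]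
      simp only [inner_sub_left, inner_sub_right, inner_smul_left, inner_smul_right, conj_trivial]
      ring) ρ hρ
    (by
      intro p hp
      obtain ⟨x, y, h⟩ := hmax p.fst p.snd ((hnf p).trans_lt hp) ((hns p).trans_lt hp)
      refine ⟨WithLp.toLp 2 (x, y), fun z' => ?_⟩
      rw [hΨ, hΨ]
      exact h _ _)
  let i1 : E →L[ℝ] WithLp 2 (E × E) := LinearMap.toContinuousLinearMap
    { toFun := fun x => WithLp.toLp 2 (x, 0)
      map_add' := fun a b => by apply WithLp.ofLp_injective; ext <;> simp
      map_smul' := fun c a => by apply WithLp.ofLp_injective; ext <;> simp }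
  let i2 : E →L[ℝ] WithLp 2 (E × E) := LinearMap.toContinuousLinearMap
    { toFun := fun x => WithLp.toLp 2 (0, x)
      map_add' := fun a b => by apply WithLp.ofLp_injective; ext <;> simp
      map_smul' := fun c a => by apply WithLp.ofLp_injective; ext <;> simp }
  have i1f : ∀ x, (i1 x).fst = x := fun x => rfl
  have i1s : ∀ x, (i1 x).snd = 0 := fun x => rfl
  have i2f : ∀ x, (i2 x).fst = 0 := fun x => rfl
  have i2s : ∀ x, (i2 x).snd = x := fun x => rfl
  let f1 : WithLp 2 (E × E) →L[ℝ] E := LinearMap.toContinuousLinearMap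
    { toFun := fun z => z.fst
      map_add' := fun a b => rfl
      map_smul' := fun c a => rfl }
  let f2 : WithLp 2 (E × E) →L[ℝ] E := LinearMap.toContinuousLinearMap
    { toFun := fun z => z.snd
      map_add' := fun a b => rfl
      map_smul' := fun c a => rfl }
  have hX : ∀ a, inner ℝ ((f1.comp (S.comp i1)) a) a = inner ℝ (S (i1 a)) (i1 a) := by
    intro a
    rw [ts_inner, i1f, i1s, inner_zero_right, add_zero]; rfl
  have hY : ∀ a, inner ℝ ((f2.comp (S.comp i2)) a) a = inner ℝ (S (i2 a)) (i2 a) := by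
    intro a
    rw [ts_inner, i2f, i2s, inner_zero_right, zero_add]; rfl
  have n1 : ∀ a, ‖i1 a‖ ^ 2 = ‖a‖ ^ 2 := fun a => by
    rw [WithLp.prod_norm_sq_eq_of_L2, i1f, i1s]; simp
  have n2 : ∀ a, ‖i2 a‖ ^ 2 = ‖a‖ ^ 2 := fun a => by
    rw [WithLp.prod_norm_sq_eq_of_L2, i2f, i2s]; simp
  have n1' : ∀ a, ‖i1 a‖ = ‖a‖ := fun a =>
    (sq_eq_sq₀ (norm_nonneg _) (norm_nonneg _)).mp (n1 a)
  have n2' : ∀ a, ‖i2 a‖ = ‖a‖ := fun a =>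
    (sq_eq_sq₀ (norm_nonneg _) (norm_nonneg _)).mp (n2 a)
  have E1 : ∀ η : ℝ, 0 < η → ∃ δ : ℝ, 0 < δ ∧ ∀ h : E, ‖h‖ < δ →
        |g1 (z.fst + h) - g1 z.fst - inner ℝ (s1 z.fst) h
          - inner ℝ ((f1.comp (S.comp i1)) h) h / 2| ≤ η * ‖h‖ ^ 2 := by
    intro η hη
    obtain ⟨δ, hδ, hd⟩ := hexp η hη
    refine ⟨δ, hδ, fun h hh => ?_⟩
    have := hd (i1 h) (by rwa [n1'])
    rw [n1, ts_inner (WithLp.toLp 2 (s1 z.fst, s2 z.snd)), i1f, i1s, ← hX] at this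
    simp only [WithLp.add_fst, WithLp.add_snd, i1f, i1s, add_zero, inner_zero_right, ts_fst, ts_snd] at this
    convert this using 2
    ring
  have E2 : ∀ η : ℝ, 0 < η → ∃ δ : ℝ, 0 < δ ∧ ∀ h : E, ‖h‖ < δ →
        |g2 (z.snd + h) - g2 z.snd - inner ℝ (s2 z.snd) h
          - inner ℝ ((f2.comp (S.comp i2)) h) h / 2| ≤ η * ‖h‖ ^ 2 := by
    intro η hη
    obtain ⟨δ, hδ, hd⟩ := hexp η hη
    refine ⟨δ, hδ, fun h hh => ?_⟩
    have := hd (i2 h) (by rwa [n2'])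
    rw [n2, ts_inner (WithLp.toLp 2 (s1 z.fst, s2 z.snd)), i2f, i2s, ← hY] at this
    simp only [WithLp.add_fst, WithLp.add_snd, i2f, i2s, add_zero, zero_add, inner_zero_right,
      ts_fst, ts_snd] at this
    convert this using 2
    ring
  refine ⟨z.fst, z.snd, p.fst, p.snd, f1.comp (S.comp i1), f2.comp (S.comp i2),
    (hnf p).trans_lt hp, (hns p).trans_lt hp, ?_, ?_, ?_, E1, E2, ?_⟩
  · intro x2 y2
    have := hz (WithLp.toLp 2 (x2, y2))
    rw [hΨ, hΨ] at this
    exact this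
  · have := congrArg WithLp.fst hsz
    rw [WithLp.add_fst, tsB_fst] at this
    exact this
  · have := congrArg WithLp.snd hsz
    rw [WithLp.add_snd, tsB_snd] at this
    exact this
  · intro a b
    have hSab := hS (i1 a + i2 b)
    rw [ts_inner (tsB _), tsB_fst, tsB_snd, ts_quad] at hSab
    simp only [WithLp.add_fst, WithLp.add_snd, i1f, i1s, i2f, i2s, add_zero, zero_add] at hSab
    refine le_trans ?_ hSab
    apply le_of_forall_pos_le_add
    intro e he
    set R : ℝ := ‖a‖ ^ 2 + ‖b‖ ^ 2 + 1 with hR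
    have hRpos : 0 < R := by positivity
    obtain ⟨δ0, hδ0, hd0⟩ := hexp (e / (4 * R)) (by positivity)
    obtain ⟨δ1, hδ1, hd1⟩ := E1 (e / (4 * R)) (by positivity)
    obtain ⟨δ2, hδ2, hd2⟩ := E2 (e / (4 * R)) (by positivity)
    set δ := min δ0 (min δ1 δ2) with hδ
    have hδpos : 0 < δ := by positivity
    set t : ℝ := δ / (‖a‖ + ‖b‖ + 1) with ht
    have htpos : 0 < t := by positivity
    have hta : t * (‖a‖ + ‖b‖) < δ := by
      rw [ht, div_mul_eq_mul_div, div_lt_iff₀ (by positivity)]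
      nlinarith
    have na : ‖t • a‖ = t * ‖a‖ := by rw [norm_smul, Real.norm_eq_abs, abs_of_pos htpos]
    have nb : ‖t • b‖ = t * ‖b‖ := by rw [norm_smul, Real.norm_eq_abs, abs_of_pos htpos]
    have pa : 0 ≤ t * ‖a‖ := by positivity
    have pb : 0 ≤ t * ‖b‖ := by positivity
    have k1 := hd1 (t • a) (by
      rw [na]; have : δ ≤ δ1 := (min_le_right _ _).trans (min_le_left _ _); linarith)
    have k2 := hd2 (t • b) (by
      rw [nb]; have : δ ≤ δ2 := (min_le_right _ _).trans (min_le_right _ _); linarith)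
    have k0 := hd0 (t • (i1 a + i2 b)) (by
      have : δ ≤ δ0 := min_le_left _ _
      have h2 := norm_add_le (i1 a) (i2 b)
      rw [n1', n2'] at h2
      rw [norm_smul, Real.norm_eq_abs, abs_of_pos htpos]
      have := mul_le_mul_of_nonneg_left h2 htpos.le
      linarith)
    have n0 : ‖t • (i1 a + i2 b)‖ ^ 2 = t ^ 2 * (‖a‖ ^ 2 + ‖b‖ ^ 2) := by
      rw [norm_smul, mul_pow, WithLp.prod_norm_sq_eq_of_L2]
      simp [i1f, i1s, i2f, i2s]
    rw [n0, ts_inner (WithLp.toLp 2 (s1 z.fst, s2 z.snd))] at k0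
    simp only [WithLp.add_fst, WithLp.add_snd, WithLp.smul_fst, WithLp.smul_snd, i1f, i1s, i2f,
      i2s, add_zero, zero_add, ts_fst, ts_snd] at k0
    rw [na] at k1
    rw [nb] at k2
    have q0 : inner ℝ (S (t • (i1 a + i2 b))) (t • (i1 a + i2 b))
        = t ^ 2 * inner ℝ (S (i1 a + i2 b)) (i1 a + i2 b) := by
      simp only [map_smul, inner_smul_left, inner_smul_right, conj_trivial]; ring
    have q1 : inner ℝ ((f1.comp (S.comp i1)) (t • a)) (t • a)
        = t ^ 2 * inner ℝ ((f1.comp (S.comp i1)) a) a := by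
      simp only [map_smul, inner_smul_left, inner_smul_right, conj_trivial]; ring
    have q2 : inner ℝ ((f2.comp (S.comp i2)) (t • b)) (t • b)
        = t ^ 2 * inner ℝ ((f2.comp (S.comp i2)) b) b := by
      simp only [map_smul, inner_smul_left, inner_smul_right, conj_trivial]; ring
    rw [q0] at k0
    rw [q1] at k1
    rw [q2] at k2
    have hk : e / (4 * R) * (t ^ 2 * (‖a‖ ^ 2 + ‖b‖ ^ 2)) ≤ t ^ 2 * (e / 4) := by
      have : e / (4 * R) * (t ^ 2 * (‖a‖ ^ 2 + ‖b‖ ^ 2))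
          = t ^ 2 * (e / 4) * ((‖a‖ ^ 2 + ‖b‖ ^ 2) / R) := by field_simp
      rw [this]
      apply mul_le_of_le_one_right (by positivity)
      rw [div_le_one hRpos]; linarith
    have k0' := (abs_le.mp k0).2
    have k1' := (abs_le.mp k1).1
    have k2' := (abs_le.mp k2).1
    have k0'' := (abs_le.mp k0).1
    have k1'' := (abs_le.mp k1).2
    have k2'' := (abs_le.mp k2).2
    have hsum : e / (4 * R) * (t * ‖a‖) ^ 2 + e / (4 * R) * (t * ‖b‖) ^ 2
        = e / (4 * R) * (t ^ 2 * (‖a‖ ^ 2 + ‖b‖ ^ 2)) := by ring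
    have : t ^ 2 * (inner ℝ ((f1.comp (S.comp i1)) a) a + inner ℝ ((f2.comp (S.comp i2)) b) b)
      ≤ t ^ 2 * (inner ℝ (S (i1 a + i2 b)) (i1 a + i2 b) + e) := by
      rw [mul_add, mul_add]
      clear_value t
      linarith
    exact le_of_mul_le_mul_left this (by positivity)

end TS

section TS2

variable {E : Type*} [NormedAddCommGroup E] [InnerProductSpace ℝ E]

lemma ts_square (a b x2 y2 : E) :
    inner ℝ a x2 + inner ℝ b y2 - (‖x2‖ ^ 2 + ‖y2‖ ^ 2) / 2 - ‖x2 - y2‖ ^ 2 / 4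
      = (3 / 8) * (‖a‖ ^ 2 + ‖b‖ ^ 2) + (1 / 4) * inner ℝ a b
        - (‖x2 - ((3 / 4 : ℝ) • a + (1 / 4 : ℝ) • b)‖ ^ 2
          + ‖y2 - ((1 / 4 : ℝ) • a + (3 / 4 : ℝ) • b)‖ ^ 2) / 2
        - ‖(x2 - ((3 / 4 : ℝ) • a + (1 / 4 : ℝ) • b))
          - (y2 - ((1 / 4 : ℝ) • a + (3 / 4 : ℝ) • b))‖ ^ 2 / 4 := by
  simp only [← real_inner_self_eq_norm_sq, inner_sub_left, inner_sub_right, inner_add_left,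
    inner_add_right, inner_smul_left, inner_smul_right, conj_trivial]
  rw [real_inner_comm a b, real_inner_comm a x2, real_inner_comm a y2, real_inner_comm b x2,
    real_inner_comm b y2, real_inner_comm x2 y2]
  ring

lemma ts_square_le (a b x2 y2 : E) :
    inner ℝ a x2 + inner ℝ b y2 - (‖x2‖ ^ 2 + ‖y2‖ ^ 2) / 2 - ‖x2 - y2‖ ^ 2 / 4
      ≤ (3 / 8) * (‖a‖ ^ 2 + ‖b‖ ^ 2) + (1 / 4) * inner ℝ a b := by
  rw [ts_square a b x2 y2]
  have := sq_nonneg ‖x2 - ((3 / 4 : ℝ) • a + (1 / 4 : ℝ) • b)‖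
  have := sq_nonneg ‖y2 - ((1 / 4 : ℝ) • a + (3 / 4 : ℝ) • b)‖
  have := sq_nonneg ‖(x2 - ((3 / 4 : ℝ) • a + (1 / 4 : ℝ) • b))
          - (y2 - ((1 / 4 : ℝ) • a + (3 / 4 : ℝ) • b))‖
  linarith

lemma ts_square_eq (a b x2 y2 : E) (hx : x2 = (3 / 4 : ℝ) • a + (1 / 4 : ℝ) • b)
    (hy : y2 = (1 / 4 : ℝ) • a + (3 / 4 : ℝ) • b) :
    inner ℝ a x2 + inner ℝ b y2 - (‖x2‖ ^ 2 + ‖y2‖ ^ 2) / 2 - ‖x2 - y2‖ ^ 2 / 4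
      = (3 / 8) * (‖a‖ ^ 2 + ‖b‖ ^ 2) + (1 / 4) * inner ℝ a b := by
  rw [ts_square a b x2 y2, ← hx, ← hy]
  simp

lemma ts_sup (C : Set E) (hC : IsCompact C) (hne : C.Nonempty) (u : E → ℝ)
    (hu : UpperSemicontinuousOn u C) (l : ℝ) (hl : 0 < l) :
    ∃ m : E → E, (∀ x, m x ∈ C) ∧ ∀ x, ∀ x' ∈ C,
      l * u x' - ‖x'‖ ^ 2 / 2 + inner ℝ x' x ≤ l * u (m x) - ‖m x‖ ^ 2 / 2 + inner ℝ (m x) x := by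
  have : ∀ x, ∃ m ∈ C, ∀ x' ∈ C,
      l * u x' - ‖x'‖ ^ 2 / 2 + inner ℝ x' x ≤ l * u m - ‖m‖ ^ 2 / 2 + inner ℝ m x := by
    intro x
    have h1 : UpperSemicontinuousOn
        (fun x' => l * u x' + (- ‖x'‖ ^ 2 / 2 + inner ℝ x' x)) C := by
      apply UpperSemicontinuousOn.add
      · intro y hy
        have : ContinuousAt (fun r : ℝ => l * r) (u y) := by fun_prop
        exact this.comp_upperSemicontinuousWithinAt (hu y hy)
          (fun a b hab => mul_le_mul_of_nonneg_left hab hl.le)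
      · have : Continuous (fun x' : E => - ‖x'‖ ^ 2 / 2 + inner ℝ x' x) := by fun_prop
        exact this.upperSemicontinuous.upperSemicontinuousOn _
    obtain ⟨m, hm, hmax⟩ := h1.exists_isMaxOn hne hC
    refine ⟨m, hm, fun x' hx' => ?_⟩
    have := hmax hx'
    simp only [mem_ofPred_eq] at this
    linarith
  choose m h1 h2 using this
  exact ⟨m, h1, h2⟩

lemma ts_jet (C : Set E) (u : E → ℝ) (l : ℝ) (hl : 0 < l) (g : E → ℝ) (x x' : E) (X : E →L[ℝ] E)
    (hg : ∀ z, ∀ y ∈ C, l * u y - ‖y‖ ^ 2 / 2 + inner ℝ y z ≤ g z)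
    (hgx : g x = l * u x' - ‖x'‖ ^ 2 / 2 + inner ℝ x' x)
    (hexp : ∀ η : ℝ, 0 < η → ∃ δ : ℝ, 0 < δ ∧ ∀ h : E, ‖h‖ < δ →
        |g (x + h) - g x - inner ℝ x' h - inner ℝ (X h) h / 2| ≤ η * ‖h‖ ^ 2) :
    ∀ e : ℝ, 0 < e → ∃ δ : ℝ, 0 < δ ∧ ∀ ξ ∈ C, ‖ξ - x'‖ < δ →
      u ξ ≤ u x' + inner ℝ (l⁻¹ • (x' - x)) (ξ - x')
        + inner ℝ ((l⁻¹ • (X - ContinuousLinearMap.id ℝ E)) (ξ - x')) (ξ - x') / 2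
        + e * ‖ξ - x'‖ ^ 2 := by
  intro e he
  obtain ⟨δ, hδ, hd⟩ := hexp (l * e) (by positivity)
  refine ⟨δ, hδ, fun ξ hξ hh => ?_⟩
  obtain ⟨h, rfl⟩ : ∃ h, ξ = x' + h := ⟨ξ - x', by abel⟩
  rw [add_sub_cancel_left] at hh ⊢
  have h1 := hg (x + h) _ hξ
  have h2 := (abs_le.mp (hd h hh)).2
  rw [hgx] at h2
  have e1 : ((l⁻¹ • (X - ContinuousLinearMap.id ℝ E)) h) = l⁻¹ • (X h - h) := rfl
  rw [e1, inner_smul_left, inner_smul_left, inner_sub_left, inner_sub_left, conj_trivial,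
    real_inner_self_eq_norm_sq]
  rw [norm_add_sq_real, inner_add_left, inner_add_right, inner_add_right,
    real_inner_self_eq_norm_sq, real_inner_comm x h] at h1
  have key : l * u (x' + h) ≤ l * (u x' + l⁻¹ * (inner ℝ x' h - inner ℝ x h)
      + l⁻¹ * (inner ℝ (X h) h - ‖h‖ ^ 2) / 2 + e * ‖h‖ ^ 2) := by
    have e2 : l * (u x' + l⁻¹ * (inner ℝ x' h - inner ℝ x h)
      + l⁻¹ * (inner ℝ (X h) h - ‖h‖ ^ 2) / 2 + e * ‖h‖ ^ 2)
      = l * u x' + (inner ℝ x' h - inner ℝ x h)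
      + (inner ℝ (X h) h - ‖h‖ ^ 2) / 2 + l * e * ‖h‖ ^ 2 := by
      field_simp
    rw [e2]
    linarith
  exact le_of_mul_le_mul_left key hl

lemma ts_sq_aux (a b : ℝ) : (a + b) ^ 2 / 2 ≤ a ^ 2 + b ^ 2 := by
  nlinarith [sq_nonneg (a - b)]

variable [FiniteDimensional ℝ E]

set_option maxHeartbeats 1000000 in

theorem ts_main (C1 C2 : Set E) (hC1 : IsCompact C1) (hC2 : IsCompact C2) (u1 u2 : E → ℝ)
    (hu1 : UpperSemicontinuousOn u1 C1) (hu2 : UpperSemicontinuousOn u2 C2)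
    (ε η : ℝ) (hε : 0 < ε) (hη : 0 < η) (xh yh : E) (hxh : xh ∈ C1) (hyh : yh ∈ C2)
    (hmax : ∀ x ∈ C1, ∀ y ∈ C2, u1 x + u2 y - ‖x - y‖ ^ 2 / (2 * ε)
      + η * (‖x - xh‖ ^ 2 + ‖y - yh‖ ^ 2) ≤ u1 xh + u2 yh - ‖xh - yh‖ ^ 2 / (2 * ε))
    (τ : ℝ) (hτ : 0 < τ) :
    ∃ (x y p q : E) (X Y : E →L[ℝ] E), x ∈ C1 ∧ y ∈ C2 ∧ ‖x - xh‖ < τ ∧ ‖y - yh‖ < τ ∧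
      ‖p - (1 / ε) • (xh - yh)‖ < τ ∧ ‖q + (1 / ε) • (xh - yh)‖ < τ ∧
      (∀ e : ℝ, 0 < e → ∃ δ : ℝ, 0 < δ ∧ ∀ ξ ∈ C1, ‖ξ - x‖ < δ →
        u1 ξ ≤ u1 x + inner ℝ p (ξ - x) + inner ℝ (X (ξ - x)) (ξ - x) / 2 + e * ‖ξ - x‖ ^ 2) ∧
      (∀ e : ℝ, 0 < e → ∃ δ : ℝ, 0 < δ ∧ ∀ ξ ∈ C2, ‖ξ - y‖ < δ →
        u2 ξ ≤ u2 y + inner ℝ q (ξ - y) + inner ℝ (Y (ξ - y)) (ξ - y) / 2 + e * ‖ξ - y‖ ^ 2) ∧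
      ∀ a b, inner ℝ (X a) a + inner ℝ (Y b) b ≤ (2 / ε) * ‖a - b‖ ^ 2 := by
  obtain ⟨l, hl⟩ : ∃ l, l = ε / 4 := ⟨_, rfl⟩
  have hl0 : 0 < l := by rw [hl]; positivity
  obtain ⟨m1, hm1, hk1⟩ := ts_sup C1 hC1 ⟨_, hxh⟩ u1 hu1 l hl0
  obtain ⟨m2, hm2, hk2⟩ := ts_sup C2 hC2 ⟨_, hyh⟩ u2 hu2 l hl0
  obtain ⟨g1, hg1⟩ : ∃ g1 : E → ℝ, ∀ x, g1 x = l * u1 (m1 x) - ‖m1 x‖ ^ 2 / 2 + inner ℝ (m1 x) x :=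
    ⟨_, fun x => rfl⟩
  obtain ⟨g2, hg2⟩ : ∃ g2 : E → ℝ, ∀ x, g2 x = l * u2 (m2 x) - ‖m2 x‖ ^ 2 / 2 + inner ℝ (m2 x) x :=
    ⟨_, fun x => rfl⟩
  simp only [← hg1] at hk1
  simp only [← hg2] at hk2
  have hs1 : ∀ z z', g1 z + inner ℝ (m1 z) (z' - z) ≤ g1 z' := by
    intro z z'
    have := hk1 z' _ (hm1 z)
    rw [hg1 z, inner_sub_right]; linarith
  have hs2 : ∀ z z', g2 z + inner ℝ (m2 z) (z' - z) ≤ g2 z' := by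
    intro z z'
    have := hk2 z' _ (hm2 z)
    rw [hg2 z, inner_sub_right]; linarith
  obtain ⟨τ', hτ'⟩ : ∃ τ', τ' = min τ (ε * τ / 4) := ⟨_, rfl⟩
  have hτ0 : 0 < τ' := by rw [hτ']; positivity
  have hτ1 : τ' ≤ τ := by rw [hτ']; exact min_le_left _ _
  have hτ2 : τ' ≤ ε * τ / 4 := by rw [hτ']; exact min_le_right _ _
  obtain ⟨ρ, hρ⟩ : ∃ ρ, ρ = min (τ' / 4) (l * η * τ' / 8) := ⟨_, rfl⟩
  have hρ0 : 0 < ρ := by rw [hρ]; positivity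
  have hρ1 : ρ ≤ τ' / 4 := by rw [hρ]; exact min_le_left _ _
  have hρ2 : ρ ≤ l * η * τ' / 8 := by rw [hρ]; exact min_le_right _ _
  have hper : ∀ p q : E, ‖p‖ < ρ → ‖q‖ < ρ → ∃ x y, ∀ x2 y2,
      tsPsi g1 g2 p q x2 y2 ≤ tsPsi g1 g2 p q x y := by
    intro p q _ _
    have husc : UpperSemicontinuousOn (fun z : E × E => (l * u1 z.1 + l * u2 z.2) +
        (- ‖z.1‖ ^ 2 / 2 - ‖z.2‖ ^ 2 / 2 + (3 / 8) * (‖z.1 - p‖ ^ 2 + ‖z.2 - q‖ ^ 2)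
          + (1 / 4) * inner ℝ (z.1 - p) (z.2 - q))) (C1 ×ˢ C2) := by
      apply UpperSemicontinuousOn.add
      · apply UpperSemicontinuousOn.add
        · intro y hy
          have : ContinuousAt (fun r : ℝ => l * r) (u1 y.1) := by fun_prop
          refine this.comp_upperSemicontinuousWithinAt (f := fun z : E × E => u1 z.1) ?_
            (fun a b hab => mul_le_mul_of_nonneg_left hab hl0.le)
          intro r hr
          have h1 := hu1 y.1 hy.1 r hr
          have h2 : Tendsto (fun z : E × E => z.1) (nhdsWithin y (C1 ×ˢ C2)) (nhdsWithin y.1 C1) :=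
            continuous_fst.continuousWithinAt.tendsto_nhdsWithin (fun z hz => hz.1)
          exact h2.eventually h1
        · intro y hy
          have : ContinuousAt (fun r : ℝ => l * r) (u2 y.2) := by fun_prop
          refine this.comp_upperSemicontinuousWithinAt (f := fun z : E × E => u2 z.2) ?_
            (fun a b hab => mul_le_mul_of_nonneg_left hab hl0.le)
          intro r hr
          have h1 := hu2 y.2 hy.2 r hr
          have h2 : Tendsto (fun z : E × E => z.2) (nhdsWithin y (C1 ×ˢ C2)) (nhdsWithin y.2 C2) :=
            continuous_snd.continuousWithinAt.tendsto_nhdsWithin (fun z hz => hz.2)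
          exact h2.eventually h1
      · apply UpperSemicontinuous.upperSemicontinuousOn
        apply Continuous.upperSemicontinuous
        fun_prop
    have hne : (C1 ×ˢ C2).Nonempty := ⟨(xh, yh), hxh, hyh⟩
    obtain ⟨⟨x', y'⟩, hz, hzmax⟩ := husc.exists_isMaxOn hne (hC1.prod hC2)
    refine ⟨(3 / 4 : ℝ) • (x' - p) + (1 / 4 : ℝ) • (y' - q),
      (1 / 4 : ℝ) • (x' - p) + (3 / 4 : ℝ) • (y' - q), fun x2 y2 => ?_⟩
    have h1 := hzmax (show (m1 x2, m2 y2) ∈ C1 ×ˢ C2 from ⟨hm1 _, hm2 _⟩)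
    simp only [mem_ofPred_eq] at h1
    have h2 := ts_square_le (m1 x2 - p) (m2 y2 - q) x2 y2
    have h3 := ts_square_eq (x' - p) (y' - q) _ _ rfl rfl
    have h4 := hk1 ((3 / 4 : ℝ) • (x' - p) + (1 / 4 : ℝ) • (y' - q)) x' hz.1
    have h5 := hk2 ((1 / 4 : ℝ) • (x' - p) + (3 / 4 : ℝ) • (y' - q)) y' hz.2
    generalize (3 / 4 : ℝ) • (x' - p) + (1 / 4 : ℝ) • (y' - q) = x at *
    generalize (1 / 4 : ℝ) • (x' - p) + (3 / 4 : ℝ) • (y' - q) = y at *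
    simp only [tsPsi]
    rw [hg1 x2, hg2 y2]
    have e1 : ∀ a b c : E, inner ℝ (a - b) c = inner ℝ a c - inner ℝ b c :=
      fun a b c => inner_sub_left _ _ _
    rw [e1 _ _ x2, e1 _ _ y2] at h2
    rw [e1 _ _ x, e1 _ _ y] at h3
    linarith
  obtain ⟨x, y, p, q, X, Y, hp, hq, hM, hx, hy, hX, hY, hXY⟩ :=
    ts_core g1 g2 m1 m2 hs1 hs2 ρ hρ0 hper
  have ex : x = (3 / 4 : ℝ) • (m1 x - p) + (1 / 4 : ℝ) • (m2 y - q) := by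
    rw [hx, hy]; module
  have ey : y = (1 / 4 : ℝ) • (m1 x - p) + (3 / 4 : ℝ) • (m2 y - q) := by
    rw [hx, hy]; module
  have hgx := hg1 x
  have hgy := hg2 y
  have hx1 := hm1 x
  have hy1 := hm2 y
  generalize m1 x = x' at *
  generalize m2 y = y' at *
  -- closeness
  obtain ⟨S, hS⟩ : ∃ S, S = ‖x' - xh‖ + ‖y' - yh‖ := ⟨_, rfl⟩
  have hSτ : S < τ' := by
    obtain ⟨x2, hx2⟩ : ∃ x2, x2 = (3 / 4 : ℝ) • xh + (1 / 4 : ℝ) • yh := ⟨_, rfl⟩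
    obtain ⟨y2, hy2⟩ : ∃ y2, y2 = (1 / 4 : ℝ) • xh + (3 / 4 : ℝ) • yh := ⟨_, rfl⟩
    have h1 := hM x2 y2
    simp only [tsPsi] at h1
    have h2 := ts_square_eq xh yh x2 y2 hx2 hy2
    have h3 := ts_square_le x' y' x y
    have h4 := hk1 x2 xh hxh
    have h5 := hk2 y2 yh hyh
    have h6 := mul_le_mul_of_nonneg_left (hmax x' hx1 y' hy1) hl0.le
    have e6 : ∀ r : ℝ, l * (r / (2 * ε)) = r / 8 := by
      intro r; rw [hl]; field_simp; ring
    rw [mul_add, mul_sub, mul_sub, e6, e6, norm_sub_sq_real x' y', norm_sub_sq_real xh yh] at h6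
    have h7 : l * (η * (‖x' - xh‖ ^ 2 + ‖y' - yh‖ ^ 2)) ≤ inner ℝ p (x2 - x) + inner ℝ q (y2 - y) := by
      rw [inner_sub_right, inner_sub_right]
      linarith
    have b1 : ‖x2 - x‖ ≤ (3 / 4) * ‖x' - xh‖ + (1 / 4) * ‖y' - yh‖ + ρ := by
      have : x2 - x = -((3 / 4 : ℝ) • (x' - xh)) - (1 / 4 : ℝ) • (y' - yh)
          + ((3 / 4 : ℝ) • p + (1 / 4 : ℝ) • q) := by
        rw [hx2, ex]; module
      rw [this]
      refine (norm_add_le _ _).trans ?_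
      have k1 := norm_sub_le (-((3 / 4 : ℝ) • (x' - xh))) ((1 / 4 : ℝ) • (y' - yh))
      have k2 := norm_add_le ((3 / 4 : ℝ) • p) ((1 / 4 : ℝ) • q)
      rw [norm_neg] at k1
      simp only [norm_smul, Real.norm_eq_abs] at k1 k2
      rw [abs_of_pos (by norm_num), abs_of_pos (by norm_num)] at k1 k2
      linarith
    have b2 : ‖y2 - y‖ ≤ (1 / 4) * ‖x' - xh‖ + (3 / 4) * ‖y' - yh‖ + ρ := by
      have : y2 - y = -((1 / 4 : ℝ) • (x' - xh)) - (3 / 4 : ℝ) • (y' - yh)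
          + ((1 / 4 : ℝ) • p + (3 / 4 : ℝ) • q) := by
        rw [hy2, ey]; module
      rw [this]
      refine (norm_add_le _ _).trans ?_
      have k1 := norm_sub_le (-((1 / 4 : ℝ) • (x' - xh))) ((3 / 4 : ℝ) • (y' - yh))
      have k2 := norm_add_le ((1 / 4 : ℝ) • p) ((3 / 4 : ℝ) • q)
      rw [norm_neg] at k1
      simp only [norm_smul, Real.norm_eq_abs] at k1 k2
      rw [abs_of_pos (by norm_num), abs_of_pos (by norm_num)] at k1 k2
      linarith
    have c1 : inner ℝ p (x2 - x) ≤ ρ * ‖x2 - x‖ :=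
      (real_inner_le_norm _ _).trans (mul_le_mul_of_nonneg_right hp.le (norm_nonneg _))
    have c2 : inner ℝ q (y2 - y) ≤ ρ * ‖y2 - y‖ :=
      (real_inner_le_norm _ _).trans (mul_le_mul_of_nonneg_right hq.le (norm_nonneg _))
    have c3 : ρ * (‖x2 - x‖ + ‖y2 - y‖) ≤ ρ * (S + 2 * ρ) :=
      mul_le_mul_of_nonneg_left (by linarith) hρ0.le
    have c4 : S ^ 2 / 2 ≤ ‖x' - xh‖ ^ 2 + ‖y' - yh‖ ^ 2 := by
      rw [hS]; exact ts_sq_aux _ _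
    have c5 : (l * η) * (S ^ 2 / 2) ≤ (l * η) * (‖x' - xh‖ ^ 2 + ‖y' - yh‖ ^ 2) :=
      mul_le_mul_of_nonneg_left c4 (by positivity)
    have c6 : (l * η) * (S ^ 2 / 2) ≤ ρ * (S + 2 * ρ) := by linarith
    by_contra hcon
    push Not at hcon
    have hS0 : 0 < S := hτ0.trans_le hcon
    have c7 : ρ * (S + 2 * ρ) ≤ ρ * (S + S / 2) :=
      mul_le_mul_of_nonneg_left (by linarith) hρ0.le
    have c8 : ρ * (S + S / 2) ≤ (l * η * τ' / 8) * (S + S / 2) :=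
      mul_le_mul_of_nonneg_right hρ2 (by positivity)
    have c9 : (l * η) * (τ' * S) ≤ (l * η) * (S * S) :=
      mul_le_mul_of_nonneg_left (mul_le_mul_of_nonneg_right hcon hS0.le) (by positivity)
    have c10 : 0 < (l * η) * (S * S) := by positivity
    linarith
  have n1 := norm_nonneg (x' - xh)
  have n2 := norm_nonneg (y' - yh)
  have li : l⁻¹ = 4 / ε := by rw [hl]; field_simp
  have hfin : ∀ a b c c' : E, ‖a‖ < ρ → ‖b‖ < ρ → ‖c‖ + ‖c'‖ = S →
      ‖(1 / ε) • (c - c' + ((3 : ℝ) • a + b))‖ < τ := by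
    intro a b c c' ha hb hcc
    rw [norm_smul, Real.norm_eq_abs, abs_of_pos (by positivity), one_div, inv_mul_lt_iff₀ hε]
    have k1 := norm_add_le (c - c') ((3 : ℝ) • a + b)
    have k2 := norm_sub_le c c'
    have k3 := norm_add_le ((3 : ℝ) • a) b
    rw [norm_smul, Real.norm_eq_abs, abs_of_pos (by norm_num)] at k3
    have : 0 < ε * τ := by positivity
    linarith
  refine ⟨x', y', l⁻¹ • (x' - x), l⁻¹ • (y' - y), l⁻¹ • (X - ContinuousLinearMap.id ℝ E),
    l⁻¹ • (Y - ContinuousLinearMap.id ℝ E), hx1, hy1, by linarith, by linarith, ?_, ?_,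
    ts_jet C1 u1 l hl0 g1 x x' X hk1 hgx hX, ts_jet C2 u2 l hl0 g2 y y' Y hk2 hgy hY, ?_⟩
  · convert hfin p q (x' - xh) (y' - yh) hp hq hS.symm using 2
    rw [li]
    have : x' - x = (1 / 4 : ℝ) • (x' - y') + (3 / 4 : ℝ) • p + (1 / 4 : ℝ) • q := by
      rw [ex]; module
    rw [this]
    module
  · convert hfin q p (y' - yh) (x' - xh) hq hp (by rw [hS, add_comm]) using 2
    rw [li]
    have : y' - y = (1 / 4 : ℝ) • (y' - x') + (3 / 4 : ℝ) • q + (1 / 4 : ℝ) • p := by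
      rw [ey]; module
    rw [this]
    module
  · intro a b
    have e1 : ∀ (Z : E →L[ℝ] E) (h : E),
      ((l⁻¹ • (Z - ContinuousLinearMap.id ℝ E)) h) = l⁻¹ • (Z h - h) := fun _ _ => rfl
    rw [e1, e1, inner_smul_left, inner_smul_left, inner_sub_left, inner_sub_left, conj_trivial,
      real_inner_self_eq_norm_sq, real_inner_self_eq_norm_sq, li]
    have := mul_le_mul_of_nonneg_left (hXY a b) (show (0 : ℝ) ≤ 4 / ε by positivity)
    have e2 : 2 / ε * ‖a - b‖ ^ 2 = 4 / ε * (‖a - b‖ ^ 2 / 2) := by ring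
    rw [e2]
    linarith

end TS2

section Jets

lemma quad_hasFDeriv {E : Type*} [NormedAddCommGroup E] [InnerProductSpace ℝ E] (P : E)
    (S : E →L[ℝ] E) (z : E) :
    ∃ Q' : E →L[ℝ] ℝ, HasFDerivAt (fun z => inner ℝ P z + inner ℝ (S z) z / 2) Q' z ∧
      ∀ h, Q' h = inner ℝ P h + (inner ℝ (S z) h + inner ℝ (S h) z) / 2 := by
  have h1 : HasFDerivAt (fun z => inner ℝ P z) (innerSL ℝ P) z := (innerSL ℝ P).hasFDerivAt
  have h2 := (S.hasFDerivAt (x := z)).inner ℝ (hasFDerivAt_id z)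
  have h3 := h1.add (h2.mul_const (1 / 2 : ℝ))
  refine ⟨_, h3.congr_of_eventuallyEq (Eventually.of_forall fun y => ?_), fun h => ?_⟩
  · simp [div_eq_mul_inv]
  · simp
    ring

/-- time injection -/
def jT (d : ℕ) : ℝ →L[ℝ] WithLp 2 (ℝ × Euc d) :=
  LinearMap.toContinuousLinearMap
    { toFun := fun t => WithLp.toLp 2 (t, 0)
      map_add' := fun a b => by apply WithLp.ofLp_injective; ext <;> simp
      map_smul' := fun c a => by apply WithLp.ofLp_injective; ext <;> simp }

/-- space injection -/
def jX (d : ℕ) : Euc d →L[ℝ] WithLp 2 (ℝ × Euc d) :=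
  LinearMap.toContinuousLinearMap
    { toFun := fun x => WithLp.toLp 2 (0, x)
      map_add' := fun a b => by apply WithLp.ofLp_injective; ext <;> simp
      map_smul' := fun c a => by apply WithLp.ofLp_injective; ext <;> simp }

lemma jT_fst (d : ℕ) (t : ℝ) : (jT d t).fst = t := rfl
lemma jT_snd (d : ℕ) (t : ℝ) : (jT d t).snd = 0 := rfl
lemma jX_fst (d : ℕ) (x : Euc d) : (jX d x).fst = 0 := rfl
lemma jX_snd (d : ℕ) (x : Euc d) : (jX d x).snd = x := rfl

lemma j_inner {d : ℕ} (a b : WithLp 2 (ℝ × Euc d)) :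
    inner ℝ a b = a.fst * b.fst + inner ℝ a.snd b.snd := by
  rw [WithLp.prod_inner_apply]
  simp [mul_comm]

lemma j_eq {d : ℕ} (t : ℝ) (x : Euc d) : WithLp.toLp 2 (t, x) = jT d t + jX d x := by
  apply WithLp.ofLp_injective
  ext <;> simp [jT, jX]

/-- quadratic test function -/
def jphi (d : ℕ) (P : WithLp 2 (ℝ × Euc d)) (S : WithLp 2 (ℝ × Euc d) →L[ℝ] WithLp 2 (ℝ × Euc d))
    (z0 : WithLp 2 (ℝ × Euc d)) : ℝ × Euc d → ℝ := fun z =>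
  inner ℝ P (jT d z.1 + jX d z.2 - z0)
    + inner ℝ (S (jT d z.1 + jX d z.2 - z0)) (jT d z.1 + jX d z.2 - z0) / 2

variable {d : ℕ} (P : WithLp 2 (ℝ × Euc d))
  (S : WithLp 2 (ℝ × Euc d) →L[ℝ] WithLp 2 (ℝ × Euc d)) (z0 : WithLp 2 (ℝ × Euc d))

lemma jphi_contDiff : ContDiff ℝ 2 (jphi d P S z0) := by
  have h : ContDiff ℝ 2 (fun z : ℝ × Euc d => jT d z.1 + jX d z.2 - z0) := by fun_prop
  exact (ContDiff.inner ℝ contDiff_const h).add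
    ((ContDiff.inner ℝ (S.contDiff.comp h) h).div_const 2)

lemma jphi_space (t : ℝ) (x : Euc d) (j : Fin d) : spacePartial d j (jphi d P S z0) t x
    = inner ℝ P (jX d (EuclideanSpace.single j 1))
      + (inner ℝ (S (jT d t + jX d x - z0)) (jX d (EuclideanSpace.single j 1))
        + inner ℝ (S (jX d (EuclideanSpace.single j 1))) (jT d t + jX d x - z0)) / 2 := by
  obtain ⟨Q', h1, h2⟩ := quad_hasFDeriv P S (jT d t + jX d x - z0)
  have h3 : HasFDerivAt (fun y => jT d t + jX d y - z0) (jX d) x :=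
    (((jX d).hasFDerivAt (x := x)).const_add _).sub_const _
  have h4 := HasFDerivAt.comp x h1 h3
  unfold spacePartial
  have h5 : fderiv ℝ (fun y => jphi d P S z0 (t, y)) x = _ := h4.fderiv
  rw [h5, ContinuousLinearMap.comp_apply, h2]

lemma jphi_time (t : ℝ) (x : Euc d) (hz : z0 = WithLp.toLp 2 (t, x)) :
    timeDeriv d (jphi d P S z0) t x = P.fst := by
  obtain ⟨Q', h1, h2⟩ := quad_hasFDeriv P S (jT d t + jX d x - z0)
  have h3 : HasFDerivAt (fun s => jT d s + jX d x - z0) (jT d) t :=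
    (((jT d).hasFDerivAt (x := t)).add_const _).sub_const _
  have h4 := (HasFDerivAt.comp t h1 h3).hasDerivAt
  unfold timeDeriv
  have h5 : deriv (fun s => jphi d P S z0 (s, x)) t = _ := h4.deriv
  rw [h5, ContinuousLinearMap.comp_apply, h2, hz, j_eq, sub_self, j_inner, jT_fst, jT_snd]
  simp

lemma jphi_grad (t : ℝ) (x : Euc d) (hz : z0 = WithLp.toLp 2 (t, x)) :
    spaceGrad d (jphi d P S z0) t x = P.snd := by
  ext i
  have : spaceGrad d (jphi d P S z0) t x i = spacePartial d i (jphi d P S z0) t x := rfl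
  rw [this, jphi_space, hz, j_eq, sub_self, j_inner, jX_fst, jX_snd]
  simp [EuclideanSpace.inner_single_right]

lemma jphi_hess (t : ℝ) (x : Euc d) (i j : Fin d) :
    spaceHessian d (jphi d P S z0) t x i j =
      (inner ℝ (S (jX d (EuclideanSpace.single i 1))) (jX d (EuclideanSpace.single j 1))
        + inner ℝ (S (jX d (EuclideanSpace.single j 1))) (jX d (EuclideanSpace.single i 1))) / 2 := by
  have h0 : spaceHessian d (jphi d P S z0) t x i j
      = spacePartial d i (fun p => spacePartial d j (jphi d P S z0) p.1 p.2) t x := rfl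
  rw [h0]
  unfold spacePartial
  have h1 : ∀ y, fderiv ℝ (fun y => jphi d P S z0 (t, y)) y (EuclideanSpace.single j 1)
      = spacePartial d j (jphi d P S z0) t y := fun y => rfl
  simp only [h1, jphi_space]
  set e := jX d (EuclideanSpace.single j 1) with he
  have h3 : HasFDerivAt (fun y => jT d t + jX d y - z0) (jX d) x :=
    (((jX d).hasFDerivAt (x := x)).const_add _).sub_const _
  have h4 : HasFDerivAt (fun y => inner ℝ (S (jT d t + jX d y - z0)) e)
      (((innerSL ℝ e).comp S).comp (jX d)) x := by
    have := (((innerSL ℝ e).comp S).hasFDerivAt (x := jT d t + jX d x - z0)).comp x h3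
    exact this.congr_of_eventuallyEq (Eventually.of_forall fun y => real_inner_comm _ _)
  have h5 : HasFDerivAt (fun y => inner ℝ (S e) (jT d t + jX d y - z0))
      ((innerSL ℝ (S e)).comp (jX d)) x :=
    ((innerSL ℝ (S e)).hasFDerivAt (x := jT d t + jX d x - z0)).comp x h3
  have h6 := (((h4.add h5).mul_const (1 / 2 : ℝ)).const_add (inner ℝ P e))
  have h7 : HasFDerivAt (fun y => inner ℝ P e + (inner ℝ (S (jT d t + jX d y - z0)) e
      + inner ℝ (S e) (jT d t + jX d y - z0)) / 2) _ x :=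
    h6.congr_of_eventuallyEq (Eventually.of_forall fun y => by simp [div_eq_mul_inv])
  rw [h7.fderiv]
  simp [real_inner_comm]
  ring

/-- `k`-th column of a matrix, as a vector. -/
def mcol {n : ℕ} (M : Matrix (Fin d) (Fin n) ℝ) (k : Fin n) : Euc d :=
  WithLp.toLp 2 (fun i => M i k)

lemma mcol_sum {n : ℕ} (M : Matrix (Fin d) (Fin n) ℝ) (k : Fin n) :
    mcol M k = ∑ i, M i k • EuclideanSpace.single i (1 : ℝ) := by
  ext i
  simp [mcol, Finset.sum_apply, Pi.single_apply]

lemma jphi_trace (t : ℝ) (x : Euc d) {n : ℕ} (M : Matrix (Fin d) (Fin n) ℝ) :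
    Matrix.trace ((M * M.transpose) * spaceHessian d (jphi d P S z0) t x)
      = ∑ k, inner ℝ (S (jX d (mcol M k))) (jX d (mcol M k)) := by
  have h1 : ∀ k, inner ℝ (S (jX d (mcol M k))) (jX d (mcol M k))
      = ∑ i, ∑ j, M i k * M j k *
      inner ℝ (S (jX d (EuclideanSpace.single i 1))) (jX d (EuclideanSpace.single j 1)) := by
    intro k
    rw [mcol_sum]
    simp only [map_sum, map_smul, sum_inner, inner_sum, inner_smul_left, inner_smul_right,
      conj_trivial, Finset.mul_sum]
    rw [Finset.sum_comm]
    refine Finset.sum_congr rfl fun i _ => Finset.sum_congr rfl fun j _ => ?_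
    ring
  simp only [h1]
  simp only [Matrix.trace, Matrix.diag, Matrix.mul_apply, Matrix.transpose_apply, jphi_hess]
  set b : Fin d → Fin d → ℝ := fun i j =>
    inner ℝ (S (jX d (EuclideanSpace.single i 1))) (jX d (EuclideanSpace.single j 1)) with hb
  change ∑ i, ∑ j, (∑ k, M i k * M j k) * ((b j i + b i j) / 2) = ∑ k, ∑ i, ∑ j, M i k * M j k * b i j
  have h2 : ∑ k, ∑ i, ∑ j, M i k * M j k * b i j = ∑ i, ∑ j, (∑ k, M i k * M j k) * b i j := by
    rw [Finset.sum_comm]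
    refine Finset.sum_congr rfl fun i _ => ?_
    rw [Finset.sum_comm]
    refine Finset.sum_congr rfl fun j _ => ?_
    rw [Finset.sum_mul]
  have h3 : ∑ i, ∑ j, (∑ k, M i k * M j k) * b i j = ∑ i, ∑ j, (∑ k, M i k * M j k) * b j i := by
    rw [Finset.sum_comm]
    refine Finset.sum_congr rfl fun i _ => Finset.sum_congr rfl fun j _ => ?_
    congr 1
    exact Finset.sum_congr rfl fun k _ => mul_comm _ _
  have h4 : ∑ i, ∑ j, (∑ k, M i k * M j k) * ((b j i + b i j) / 2)
      = (∑ i, ∑ j, (∑ k, M i k * M j k) * b i j + ∑ i, ∑ j, (∑ k, M i k * M j k) * b j i) / 2 := by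
    rw [← Finset.sum_add_distrib, Finset.sum_div]
    refine Finset.sum_congr rfl fun i _ => ?_
    rw [← Finset.sum_add_distrib, Finset.sum_div]
    refine Finset.sum_congr rfl fun j _ => ?_
    ring
  rw [h4, h2, ← h3]
  ring

lemma jphi_op (A : Euc d → Matrix (Fin d) (Fin d) ℝ) (H : Euc d → Euc d → ℝ) (t : ℝ) (x : Euc d)
    {n : ℕ} (M : Matrix (Fin d) (Fin n) ℝ) (hM : A x = M * M.transpose)
    (hz : z0 = WithLp.toLp 2 (t, x)) :
    parabolicOp d A H (jphi d P S z0) t x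
      = P.fst - ∑ k, inner ℝ (S (jX d (mcol M k))) (jX d (mcol M k)) + H x P.snd := by
  unfold parabolicOp
  rw [jphi_time P S z0 t x hz, jphi_grad P S z0 t x hz, hM, jphi_trace]

lemma jX_norm (x : Euc d) : ‖jX d x‖ ^ 2 = ‖x‖ ^ 2 := by
  rw [WithLp.prod_norm_sq_eq_of_L2, jX_fst, jX_snd]; simp

lemma j_norm_le (t : ℝ) (x : Euc d) : ‖(WithLp.toLp 2 (t, x) : WithLp 2 (ℝ × Euc d))‖ ≤ 2 * ‖(t, x)‖ := by
  have h := WithLp.prod_norm_sq_eq_of_L2 (WithLp.toLp 2 (t, x) : WithLp 2 (ℝ × Euc d))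
  have h1 : ‖t‖ ≤ ‖(t, x)‖ := norm_fst_le (t, x)
  have h2 : ‖x‖ ≤ ‖(t, x)‖ := norm_snd_le (t, x)
  apply le_of_sq_le_sq _ (by positivity)
  rw [h]
  have e1 : (WithLp.toLp 2 (t, x) : WithLp 2 (ℝ × Euc d)).fst = t := rfl
  have e2 : (WithLp.toLp 2 (t, x) : WithLp 2 (ℝ × Euc d)).snd = x := rfl
  rw [e1, e2]
  have := norm_nonneg t
  have := norm_nonneg x
  nlinarith

/-- superjet condition -/
def IsJet (u : ℝ × Euc d → ℝ) (t : ℝ) (x : Euc d) (P : WithLp 2 (ℝ × Euc d))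
    (S : WithLp 2 (ℝ × Euc d) →L[ℝ] WithLp 2 (ℝ × Euc d)) : Prop :=
  ∀ e : ℝ, 0 < e → ∃ δ : ℝ, 0 < δ ∧ ∀ ξ : WithLp 2 (ℝ × Euc d),
    ‖ξ - WithLp.toLp 2 (t, x)‖ < δ →
    u (ξ.fst, ξ.snd) ≤ u (t, x) + inner ℝ P (ξ - WithLp.toLp 2 (t, x))
      + inner ℝ (S (ξ - WithLp.toLp 2 (t, x))) (ξ - WithLp.toLp 2 (t, x)) / 2
      + e * ‖ξ - WithLp.toLp 2 (t, x)‖ ^ 2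

lemma jet_localMax (u : ℝ × Euc d → ℝ) (t : ℝ) (x : Euc d) (hj : IsJet u t x P S) (e : ℝ)
    (he : 0 < e) :
    ∀ᶠ p in nhds (t, x), u p - jphi d P (S + (2 * e) • ContinuousLinearMap.id ℝ _)
        (WithLp.toLp 2 (t, x)) p
      ≤ u (t, x) - jphi d P (S + (2 * e) • ContinuousLinearMap.id ℝ _)
        (WithLp.toLp 2 (t, x)) (t, x) := by
  obtain ⟨δ, hδ, h⟩ := hj e he
  filter_upwards [Metric.ball_mem_nhds (t, x) (show 0 < δ / 2 by positivity)] with p hp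
  rw [mem_ball, dist_eq_norm] at hp
  have h1 := h (WithLp.toLp 2 (p.1, p.2)) (by
    rw [← WithLp.toLp_sub]
    refine (j_norm_le (p.1 - t) (p.2 - x)).trans_lt ?_
    have : ‖(p.1 - t, p.2 - x)‖ < δ / 2 := hp
    linarith)
  have e1 : (WithLp.toLp 2 (p.1, p.2) : WithLp 2 (ℝ × Euc d)).fst = p.1 := rfl
  have e2 : (WithLp.toLp 2 (p.1, p.2) : WithLp 2 (ℝ × Euc d)).snd = p.2 := rfl
  rw [e1, e2] at h1
  unfold jphi
  simp only [← j_eq]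
  simp only [sub_self, map_zero, inner_zero_right, _root_.add_apply, inner_add_left]
  set ζ := (WithLp.toLp 2 (p.1, p.2) : WithLp 2 (ℝ × Euc d)) - WithLp.toLp 2 (t, x)
  have e3 : inner ℝ (((2 * e) • ContinuousLinearMap.id ℝ (WithLp 2 (ℝ × Euc d))) ζ) ζ
      = 2 * e * ‖ζ‖ ^ 2 := by
    rw [← real_inner_self_eq_norm_sq, ← real_inner_smul_left]; rfl
  rw [e3]
  have : u p = u (p.1, p.2) := rfl
  rw [this]
  linarith

lemma jet_trace_aux (e : ℝ) {n : ℕ} (M : Matrix (Fin d) (Fin n) ℝ) :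
   ∑ k, inner ℝ ((S + (2 * e) • ContinuousLinearMap.id ℝ (WithLp 2 (ℝ × Euc d))) (jX d (mcol M k))) (jX d (mcol M k))
   = ∑ k, inner ℝ (S (jX d (mcol M k))) (jX d (mcol M k)) + e * (2 * ∑ k, ‖mcol M k‖ ^ 2) := by
  rw [Finset.mul_sum, Finset.mul_sum, ← Finset.sum_add_distrib]
  refine Finset.sum_congr rfl fun k _ => ?_
  rw [← jX_norm, ← real_inner_self_eq_norm_sq, _root_.add_apply, inner_add_left]
  congr 1
  have : ((2 * e) • ContinuousLinearMap.id ℝ (WithLp 2 (ℝ × Euc d))) (jX d (mcol M k))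
    = (2 * e) • jX d (mcol M k) := rfl
  rw [this, real_inner_smul_left]
  ring

lemma visc_sub_jet (A : Euc d → Matrix (Fin d) (Fin d) ℝ) (H : Euc d → Euc d → ℝ) (T : ℝ)
    (U : Set (Euc d)) (v : ℝ × Euc d → ℝ) (hv : IsViscSubsolution d A H T U v)
    (t : ℝ) (ht : t ∈ Ioo 0 T) (x : Euc d) (hx : x ∈ U) (hj : IsJet v t x P S)
    {n : ℕ} (M : Matrix (Fin d) (Fin n) ℝ) (hM : A x = M * M.transpose) :
    P.fst - ∑ k, inner ℝ (S (jX d (mcol M k))) (jX d (mcol M k)) + H x P.snd ≤ 0 := by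
  have key : ∀ e : ℝ, 0 < e → P.fst - (∑ k, inner ℝ (S (jX d (mcol M k))) (jX d (mcol M k))
      + e * (2 * ∑ k, ‖mcol M k‖ ^ 2)) + H x P.snd ≤ 0 := by
    intro e he
    have := hv _ (jphi_contDiff P (S + (2 * e) • ContinuousLinearMap.id ℝ _)
      (WithLp.toLp 2 (t, x))) t ht x hx
      (Filter.Eventually.filter_mono nhdsWithin_le_nhds (jet_localMax P S v t x hj e he))
    rw [jphi_op _ _ _ A H t x M hM rfl, jet_trace_aux] at this
    exact this
  set B := 2 * ∑ k, ‖mcol M k‖ ^ 2 with hB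
  have hB0 : 0 ≤ B := by positivity
  apply le_of_forall_pos_le_add
  intro e he
  have h1 := key (e / (B + 1)) (by positivity)
  have h2 : e / (B + 1) * B ≤ e := by
    rw [div_mul_eq_mul_div, div_le_iff₀ (by positivity)]
    nlinarith
  linarith

lemma visc_sup_jet (A : Euc d → Matrix (Fin d) (Fin d) ℝ) (H : Euc d → Euc d → ℝ) (T : ℝ)
    (U : Set (Euc d)) (w : ℝ × Euc d → ℝ) (hw : IsViscSupersolution d A H T U w)
    (t : ℝ) (ht : t ∈ Ioo 0 T) (x : Euc d) (hx : x ∈ U) (hj : IsJet (fun z => - w z) t x P S)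
    {n : ℕ} (M : Matrix (Fin d) (Fin n) ℝ) (hM : A x = M * M.transpose) :
    0 ≤ - P.fst + ∑ k, inner ℝ (S (jX d (mcol M k))) (jX d (mcol M k)) + H x (-P.snd) := by
  have key : ∀ e : ℝ, 0 < e → 0 ≤ -P.fst + (∑ k, inner ℝ (S (jX d (mcol M k))) (jX d (mcol M k))
      + e * (2 * ∑ k, ‖mcol M k‖ ^ 2)) + H x (-P.snd) := by
    intro e he
    have hneg : ∀ (S' : WithLp 2 (ℝ × Euc d) →L[ℝ] WithLp 2 (ℝ × Euc d)) z0 p,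
        jphi d (-P) (-S') z0 p = - jphi d P S' z0 p := by
      intro S' z0 p
      simp only [jphi, _root_.neg_apply, inner_neg_left]
      ring
    have hm := jet_localMax P S _ t x hj e he
    have := hw _ (jphi_contDiff (-P) (-(S + (2 * e) • ContinuousLinearMap.id ℝ _))
      (WithLp.toLp 2 (t, x))) t ht x hx
      (Filter.Eventually.filter_mono nhdsWithin_le_nhds (by
        filter_upwards [hm] with p hp
        rw [hneg, hneg]
        linarith))
    rw [jphi_op _ _ _ A H t x M hM rfl] at this
    simp only [_root_.neg_apply, inner_neg_left, Finset.sum_neg_distrib] at this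
    rw [jet_trace_aux] at this
    have e1 : (-P).fst = - P.fst := rfl
    have e2 : (-P).snd = - P.snd := rfl
    rw [e1, e2] at this
    linarith
  set B := 2 * ∑ k, ‖mcol M k‖ ^ 2 with hB
  have hB0 : 0 ≤ B := by positivity
  apply le_of_forall_pos_le_add
  intro e he
  have h1 := key (e / (B + 1)) (by positivity)
  have h2 : e / (B + 1) * B ≤ e := by
    rw [div_mul_eq_mul_div, div_le_iff₀ (by positivity)]
    nlinarith
  linarith

lemma mcol_norm {n : ℕ} (M : Matrix (Fin d) (Fin n) ℝ) (L : ℝ) (hM : matFrobNorm M ≤ L) :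
    ∑ k, ‖mcol M k‖ ^ 2 ≤ L ^ 2 := by
  have h1 : ∑ k, ‖mcol M k‖ ^ 2 = matFrobNorm M ^ 2 := by
    unfold matFrobNorm
    rw [Real.sq_sqrt (by positivity), Finset.sum_comm]
    refine Finset.sum_congr rfl fun k _ => ?_
    rw [EuclideanSpace.norm_sq_eq]
    simp [mcol]
  rw [h1]
  have h2 : 0 ≤ matFrobNorm M := Real.sqrt_nonneg _
  exact pow_le_pow_left₀ h2 hM 2

lemma mcol_sub {n : ℕ} (M N : Matrix (Fin d) (Fin n) ℝ) (k : Fin n) :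
    mcol M k - mcol N k = mcol (M - N) k := by
  ext i; simp [mcol]

end Jets

section Pen

variable {d : ℕ}

lemma j_fst_le (z : WithLp 2 (ℝ × Euc d)) : |z.fst| ≤ ‖z‖ := by
  have := WithLp.prod_norm_sq_eq_of_L2 z
  rw [← Real.norm_eq_abs]
  apply le_of_sq_le_sq _ (norm_nonneg _)
  nlinarith [sq_nonneg ‖z.snd‖]

lemma j_snd_le (z : WithLp 2 (ℝ × Euc d)) : ‖z.snd‖ ≤ ‖z‖ := by
  have := WithLp.prod_norm_sq_eq_of_L2 z
  apply le_of_sq_le_sq _ (norm_nonneg _)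
  nlinarith [sq_nonneg ‖z.fst‖]

lemma j_cont_fst : Continuous (fun z : WithLp 2 (ℝ × Euc d) => z.fst) :=
  continuous_fst.comp (WithLp.prod_continuous_ofLp 2 ℝ (Euc d))

lemma j_cont_snd : Continuous (fun z : WithLp 2 (ℝ × Euc d) => z.snd) :=
  continuous_snd.comp (WithLp.prod_continuous_ofLp 2 ℝ (Euc d))

/-- Japanese bracket -/
def jb (x : Euc d) : ℝ := Real.sqrt (1 + ‖x‖ ^ 2)

lemma jb_cont : Continuous (jb (d := d)) := by unfold jb; fun_prop

lemma jb_ge_one (x : Euc d) : 1 ≤ jb x := by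
  unfold jb
  rw [Real.one_le_sqrt]
  nlinarith [sq_nonneg ‖x‖]

lemma jb_sq (x : Euc d) : jb x ^ 2 = 1 + ‖x‖ ^ 2 := Real.sq_sqrt (by positivity)

lemma jb_ge_norm (x : Euc d) : ‖x‖ ≤ jb x := by
  apply Real.le_sqrt_of_sq_le; linarith

lemma jb_le (x : Euc d) : jb x ≤ 1 + ‖x‖ := by
  have h1 := jb_sq x
  have h2 := jb_ge_one x
  have h3 := norm_nonneg x
  nlinarith

lemma jb_lip (x y : Euc d) : jb x ≤ jb y + ‖x - y‖ := by
  have h1 := jb_sq x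
  have h2 := jb_sq y
  have h3 := jb_ge_one x
  have h4 := jb_ge_one y
  have h5 := jb_ge_norm y
  have h6 : ‖x‖ ≤ ‖y‖ + ‖x - y‖ := by
    have := norm_add_le y (x - y)
    rwa [add_sub_cancel] at this
  have h7 := norm_nonneg (x - y)
  have h8 := norm_nonneg x
  have h9 : ‖x‖ ^ 2 ≤ (‖y‖ + ‖x - y‖) ^ 2 := pow_le_pow_left₀ h8 h6 2
  apply le_of_sq_le_sq _ (by positivity)
  nlinarith [mul_le_mul_of_nonneg_right h5 h7]

lemma jb_tangent (x0 x : Euc d) :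
    jb x ≤ jb x0 + inner ℝ ((jb x0)⁻¹ • x0) (x - x0) + ‖x - x0‖ ^ 2 / 2 := by
  have h0 := jb_ge_one x0
  have h1 := jb_sq x
  have h2 := jb_sq x0
  have h3 : jb x ≤ jb x0 + (jb x ^ 2 - jb x0 ^ 2) / (2 * jb x0) := by
    rw [← sub_le_iff_le_add', le_div_iff₀ (by positivity)]
    nlinarith [sq_nonneg (jb x - jb x0)]
  have h4 : jb x ^ 2 - jb x0 ^ 2 = 2 * inner ℝ x0 (x - x0) + ‖x - x0‖ ^ 2 := by
    rw [h1, h2]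
    have := norm_add_sq_real x0 (x - x0)
    rw [add_sub_cancel] at this
    linarith
  rw [inner_smul_left, conj_trivial]
  have h5 : (jb x ^ 2 - jb x0 ^ 2) / (2 * jb x0)
    = (jb x0)⁻¹ * inner ℝ x0 (x - x0) + (jb x0)⁻¹ * (‖x - x0‖ ^ 2 / 2) := by
    rw [h4]; field_simp
  have h6 : (jb x0)⁻¹ * (‖x - x0‖ ^ 2 / 2) ≤ ‖x - x0‖ ^ 2 / 2 :=
    mul_le_of_le_one_left (by positivity) (inv_le_one_of_one_le₀ h0)
  linarith

/-- diagonal operator -/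
def jD (d : ℕ) (a b : ℝ) : WithLp 2 (ℝ × Euc d) →L[ℝ] WithLp 2 (ℝ × Euc d) :=
  LinearMap.toContinuousLinearMap
    { toFun := fun z => WithLp.toLp 2 (a * z.fst, b • z.snd)
      map_add' := fun z z' => by
        apply WithLp.ofLp_injective; ext <;> simp <;> ring
      map_smul' := fun c z => by
        apply WithLp.ofLp_injective; ext <;> simp <;> ring }

lemma jD_inner (a b : ℝ) (z : WithLp 2 (ℝ × Euc d)) :
    inner ℝ (jD d a b z) z = a * z.fst ^ 2 + b * ‖z.snd‖ ^ 2 := by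
  rw [j_inner]
  have e1 : (jD d a b z).fst = a * z.fst := rfl
  have e2 : (jD d a b z).snd = b • z.snd := rfl
  rw [e1, e2, inner_smul_left, conj_trivial, real_inner_self_eq_norm_sq]
  ring

/-- penalisation -/
def pen (d : ℕ) (T θ δ η : ℝ) (zh ξ : WithLp 2 (ℝ × Euc d)) : ℝ :=
  θ / (T - ξ.fst) + δ * jb ξ.snd + η * ‖ξ - zh‖ ^ 2

/-- gradient of the penalisation -/
def penGrad (d : ℕ) (T θ δ η : ℝ) (zh z : WithLp 2 (ℝ × Euc d)) : WithLp 2 (ℝ × Euc d) :=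
  jT d (θ / (T - z.fst) ^ 2) + jX d (δ • ((jb z.snd)⁻¹ • z.snd)) + (2 * η) • (z - zh)

lemma pen_jet (T θ δ η : ℝ) (hθ : 0 ≤ θ) (hδ : 0 ≤ δ) (zh z : WithLp 2 (ℝ × Euc d))
    (hz : z.fst < T) (ξ : WithLp 2 (ℝ × Euc d)) (hξ : ‖ξ - z‖ < (T - z.fst) / 2) :
    pen d T θ δ η zh ξ ≤ pen d T θ δ η zh z + inner ℝ (penGrad d T θ δ η zh z) (ξ - z)
      + inner ℝ (jD d (4 * θ / (T - z.fst) ^ 3 + 2 * η) (δ + 2 * η) (ξ - z)) (ξ - z) / 2 := by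
  have h1 := jb_tangent z.snd ξ.snd
  have h2 := (abs_le.mp (j_fst_le (ξ - z))).2
  have ef : (ξ - z).fst = ξ.fst - z.fst := rfl
  have es : (ξ - z).snd = ξ.snd - z.snd := rfl
  have hn : ‖ξ - z‖ ^ 2 = (ξ - z).fst ^ 2 + ‖(ξ - z).snd‖ ^ 2 := by
    rw [WithLp.prod_norm_sq_eq_of_L2, Real.norm_eq_abs, sq_abs]
  have hq : ‖ξ - zh‖ ^ 2 = ‖z - zh‖ ^ 2 + 2 * inner ℝ (z - zh) (ξ - z) + ‖ξ - z‖ ^ 2 := by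
    rw [← norm_add_sq_real]; congr 2; abel
  have hP : inner ℝ (penGrad d T θ δ η zh z) (ξ - z) = θ / (T - z.fst) ^ 2 * (ξ.fst - z.fst)
      + δ * inner ℝ ((jb z.snd)⁻¹ • z.snd) (ξ.snd - z.snd) + 2 * η * inner ℝ (z - zh) (ξ - z) := by
    unfold penGrad
    rw [inner_add_left, inner_add_left, j_inner (jT d _), j_inner (jX d _), jT_fst, jT_snd,
      jX_fst, jX_snd, inner_zero_left, real_inner_smul_left _ _ δ, real_inner_smul_left _ _ (2 * η), ef, es]
    ring
  have ht : θ / (T - ξ.fst) ≤ θ / (T - z.fst) + θ / (T - z.fst) ^ 2 * (ξ.fst - z.fst)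
      + 2 * θ / (T - z.fst) ^ 3 * (ξ.fst - z.fst) ^ 2 := by
    rw [ef] at h2
    have ha : 0 < T - z.fst := by linarith
    obtain ⟨a, hA⟩ : ∃ a, a = T - z.fst := ⟨_, rfl⟩
    obtain ⟨s, hs⟩ : ∃ s, s = ξ.fst - z.fst := ⟨_, rfl⟩
    have e : T - ξ.fst = a - s := by rw [hA, hs]; ring
    rw [e, ← hA, ← hs]
    rw [← hA] at ha hξ
    rw [← hs] at h2
    have hs2 : s < a / 2 := by linarith
    have hpos : 0 < a - s := by linarith
    have : θ / a + θ / a ^ 2 * s + 2 * θ / a ^ 3 * s ^ 2 - θ / (a - s)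
        = θ * s ^ 2 * (a - 2 * s) / (a ^ 3 * (a - s)) := by
      field_simp
      ring
    have h3 : 0 ≤ θ * s ^ 2 * (a - 2 * s) / (a ^ 3 * (a - s)) := by
      have : 0 ≤ a - 2 * s := by linarith
      positivity
    linarith
  rw [hP, jD_inner]
  unfold pen
  rw [hq, hn, ef, es]
  have h1' := mul_le_mul_of_nonneg_left h1 hδ
  have e4 : 4 * θ / (T - z.fst) ^ 3 = 2 * (2 * θ / (T - z.fst) ^ 3) := by ring
  rw [e4]
  linarith

lemma jet_add (u : WithLp 2 (ℝ × Euc d) → ℝ) (v : ℝ × Euc d → ℝ) (C : Set (WithLp 2 (ℝ × Euc d)))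
    (z p : WithLp 2 (ℝ × Euc d)) (X : WithLp 2 (ℝ × Euc d) →L[ℝ] WithLp 2 (ℝ × Euc d))
    (hC : C ∈ nhds z) (T θ δ η : ℝ) (hθ : 0 ≤ θ) (hδ : 0 ≤ δ) (zh : WithLp 2 (ℝ × Euc d))
    (hz : z.fst < T)
    (hu : ∀ ξ, u ξ = v (ξ.fst, ξ.snd) - pen d T θ δ η zh ξ)
    (hj : ∀ e : ℝ, 0 < e → ∃ δ : ℝ, 0 < δ ∧ ∀ ξ ∈ C, ‖ξ - z‖ < δ →
        u ξ ≤ u z + inner ℝ p (ξ - z) + inner ℝ (X (ξ - z)) (ξ - z) / 2 + e * ‖ξ - z‖ ^ 2) :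
    IsJet v z.fst z.snd (p + penGrad d T θ δ η zh z)
      (X + jD d (4 * θ / (T - z.fst) ^ 3 + 2 * η) (δ + 2 * η)) := by
  intro e he
  obtain ⟨r, hr, hr'⟩ := hj e he
  obtain ⟨r2, hr2, hrC⟩ := Metric.mem_nhds_iff.mp hC
  have hT : 0 < (T - z.fst) / 2 := by linarith
  refine ⟨min r (min r2 ((T - z.fst) / 2)), by positivity, fun ξ hξ => ?_⟩
  have hzz : (WithLp.toLp 2 (z.fst, z.snd) : WithLp 2 (ℝ × Euc d)) = z := rfl
  rw [hzz] at hξ ⊢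
  have h1 := hr' ξ (hrC (by
    rw [mem_ball, dist_eq_norm]
    exact hξ.trans_le ((min_le_right _ _).trans (min_le_left _ _)))) (hξ.trans_le (min_le_left _ _))
  have h2 := pen_jet T θ δ η hθ hδ zh z hz ξ
    (hξ.trans_le ((min_le_right _ _).trans (min_le_right _ _)))
  rw [hu, hu] at h1
  rw [_root_.add_apply, inner_add_left, inner_add_left]
  linarith

lemma penGrad_fst (T θ δ η : ℝ) (zh z : WithLp 2 (ℝ × Euc d)) :
    (penGrad d T θ δ η zh z).fst = θ / (T - z.fst) ^ 2 + 2 * η * (z.fst - zh.fst) := by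
  unfold penGrad
  simp [jT_fst, jX_fst]

lemma penGrad_snd (T θ δ η : ℝ) (zh z : WithLp 2 (ℝ × Euc d)) :
    (penGrad d T θ δ η zh z).snd = δ • ((jb z.snd)⁻¹ • z.snd) + (2 * η) • (z.snd - zh.snd) := by
  unfold penGrad
  simp [jT_snd, jX_snd]

lemma penGrad_snd_norm (T θ δ η : ℝ) (hδ : 0 ≤ δ) (hη : 0 ≤ η) (zh z : WithLp 2 (ℝ × Euc d)) :
    ‖(penGrad d T θ δ η zh z).snd‖ ≤ δ + 2 * η * ‖z - zh‖ := by
  rw [penGrad_snd]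
  refine (norm_add_le _ _).trans ?_
  rw [norm_smul, norm_smul, norm_smul, Real.norm_eq_abs, Real.norm_eq_abs, Real.norm_eq_abs,
    abs_of_nonneg hδ, abs_of_nonneg (by positivity : 0 ≤ 2 * η)]
  have h0 := jb_ge_one z.snd
  rw [abs_of_nonneg (by positivity)]
  have h1 : (jb z.snd)⁻¹ * ‖z.snd‖ ≤ 1 := by
    rw [inv_mul_le_iff₀ (by positivity), mul_one]; exact jb_ge_norm _
  have h2 : ‖z.snd - zh.snd‖ ≤ ‖z - zh‖ := j_snd_le (z - zh)
  have h3 := mul_le_mul_of_nonneg_left h1 hδ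
  have h4 := mul_le_mul_of_nonneg_left h2 (by positivity : 0 ≤ 2 * η)
  linarith

lemma pen_continuousOn (T θ δ η : ℝ) (zh : WithLp 2 (ℝ × Euc d)) (C : Set (WithLp 2 (ℝ × Euc d)))
    (hC : ∀ ξ ∈ C, ξ.fst < T) : ContinuousOn (pen d T θ δ η zh) C := by
  unfold pen
  have h1 := j_cont_fst (d := d)
  have h2 := jb_cont.comp (j_cont_snd (d := d))
  refine ContinuousOn.add (ContinuousOn.add ?_ ?_) ?_
  · refine ContinuousOn.div continuousOn_const (by fun_prop) ?_
    intro ξ hξ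
    have := hC ξ hξ
    linarith
  · exact (continuous_const.mul h2).continuousOn
  · fun_prop

end Pen

section Key

variable {d : ℕ}

/-- the cylinder, inside the Euclidean space-time -/
def cyl (d : ℕ) (T : ℝ) (U : Set (Euc d)) : Set (WithLp 2 (ℝ × Euc d)) :=
  {ξ | ξ.fst ∈ Ioo (0 : ℝ) T ∧ ξ.snd ∈ U}

lemma cyl_open (T : ℝ) (U : Set (Euc d)) (hU : IsOpen U) : IsOpen (cyl d T U) :=
  (isOpen_Ioo.preimage j_cont_fst).inter (hU.preimage j_cont_snd)

lemma usc_pen (u : ℝ × Euc d → ℝ) (T : ℝ) (U : Set (Euc d))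
    (hu : UpperSemicontinuousOn u (Icc 0 T ×ˢ closure U)) (θ δ η : ℝ)
    (zh : WithLp 2 (ℝ × Euc d)) (C : Set (WithLp 2 (ℝ × Euc d))) (hC : C ⊆ cyl d T U) :
    UpperSemicontinuousOn (fun ξ => u (ξ.fst, ξ.snd) - pen d T θ δ η zh ξ) C := by
  have h1 : UpperSemicontinuousOn (fun ξ : WithLp 2 (ℝ × Euc d) => u (ξ.fst, ξ.snd)) C := by
    intro ξ hξ r hr
    have hm : ∀ ζ ∈ C, (ζ.fst, ζ.snd) ∈ Icc (0 : ℝ) T ×ˢ closure U := fun ζ hζ =>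
      ⟨⟨(hC hζ).1.1.le, (hC hζ).1.2.le⟩, subset_closure (hC hζ).2⟩
    have h2 := hu (ξ.fst, ξ.snd) (hm ξ hξ) r hr
    have hc : Continuous (fun ζ : WithLp 2 (ℝ × Euc d) => (ζ.fst, ζ.snd)) :=
      j_cont_fst.prodMk j_cont_snd
    exact (hc.continuousWithinAt.tendsto_nhdsWithin hm).eventually h2
  have h2 : UpperSemicontinuousOn (fun ξ => - pen d T θ δ η zh ξ) C :=
    (pen_continuousOn T θ δ η zh C (fun ξ hξ => (hC hξ).1.2)).neg.upperSemicontinuousOn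
  have := h1.add h2
  simpa only [sub_eq_add_neg] using this

lemma key_ineq (T : ℝ) (U : Set (Euc d)) (hU : IsOpen U)
    (L : ℝ) (A : Euc d → Matrix (Fin d) (Fin d) ℝ) (hA : CondA d L A) (H : Euc d → Euc d → ℝ)
    (v w : ℝ × Euc d → ℝ)
    (hv : UpperSemicontinuousOn v (Icc 0 T ×ˢ closure U))
    (hw : LowerSemicontinuousOn w (Icc 0 T ×ˢ closure U))
    (hsub : IsViscSubsolution d A H T U v)
    (hsup : IsViscSupersolution d A H T U w)
    (θ δ ε τ : ℝ) (hθ : 0 ≤ θ) (hδ : 0 < δ) (hε : 0 < ε) (hτ : 0 < τ)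
    (z1 z2 : WithLp 2 (ℝ × Euc d)) (hz1 : z1 ∈ cyl d T U) (hz2 : z2 ∈ cyl d T U)
    (hmax : ∀ ξ1 ∈ cyl d T U, ∀ ξ2 ∈ cyl d T U,
      v (ξ1.fst, ξ1.snd) - w (ξ2.fst, ξ2.snd) - θ / (T - ξ1.fst) - δ * jb ξ1.snd - δ * jb ξ2.snd
        - ‖ξ1 - ξ2‖ ^ 2 / (2 * ε) ≤
      v (z1.fst, z1.snd) - w (z2.fst, z2.snd) - θ / (T - z1.fst) - δ * jb z1.snd - δ * jb z2.snd
        - ‖z1 - z2‖ ^ 2 / (2 * ε)) :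
    ∃ x y gx gy : Euc d, x ∈ U ∧ y ∈ U ∧ ‖x - z1.snd‖ < τ ∧ ‖y - z2.snd‖ < τ ∧
      ‖gx - (1 / ε) • (z1.snd - z2.snd)‖ ≤ τ + δ + 2 * δ * τ ∧
      ‖gy - (1 / ε) • (z1.snd - z2.snd)‖ ≤ τ + δ + 2 * δ * τ ∧
      θ / T ^ 2 ≤ 2 * τ + 4 * δ * τ + (2 / ε) * (L * ‖x - y‖) ^ 2 + 6 * δ * L ^ 2
        + (H y gy - H x gx) := by
  have hop := cyl_open T U hU
  obtain ⟨r1, hr1, hb1⟩ := Metric.nhds_basis_closedBall.mem_iff.mp (hop.mem_nhds hz1)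
  obtain ⟨r2, hr2, hb2⟩ := Metric.nhds_basis_closedBall.mem_iff.mp (hop.mem_nhds hz2)
  have hnw : UpperSemicontinuousOn (fun p => - w p) (Icc 0 T ×ˢ closure U) := hw.neg
  obtain ⟨τ', hτ'⟩ : ∃ τ', τ' = min τ (min r1 r2) := ⟨_, rfl⟩
  have hτ0 : 0 < τ' := by rw [hτ']; positivity
  have hτ1 : τ' ≤ τ := by rw [hτ']; exact min_le_left _ _
  have hτ2 : τ' ≤ r1 := by rw [hτ']; exact (min_le_right _ _).trans (min_le_left _ _)
  have hτ3 : τ' ≤ r2 := by rw [hτ']; exact (min_le_right _ _).trans (min_le_right _ _)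
  obtain ⟨x, y, p, q, X, Y, hx, hy, hxz, hyz, hp, hq, jx, jy, hXY⟩ := ts_main
    (closedBall z1 r1) (closedBall z2 r2) (isCompact_closedBall _ _) (isCompact_closedBall _ _)
    _ _ (usc_pen v T U hv θ δ δ z1 _ hb1) (usc_pen _ T U hnw 0 δ δ z2 _ hb2) ε δ hε hδ z1 z2
    (mem_closedBall_self hr1.le) (mem_closedBall_self hr2.le)
    (by
      intro ξ1 h1 ξ2 h2
      have := hmax ξ1 (hb1 h1) ξ2 (hb2 h2)
      simp only [pen, zero_div, sub_self, norm_zero]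
      linarith) τ' hτ0
  have hxc := hb1 hx
  have hyc := hb2 hy
  have nx : closedBall z1 r1 ∈ nhds x := Metric.closedBall_mem_nhds_of_mem (by
    rw [mem_ball, dist_eq_norm]; linarith)
  have ny : closedBall z2 r2 ∈ nhds y := Metric.closedBall_mem_nhds_of_mem (by
    rw [mem_ball, dist_eq_norm]; linarith)
  have Jx := jet_add _ v _ x p X nx T θ δ δ hθ hδ.le z1 hxc.1.2 (fun ξ => rfl) jx
  have Jy := jet_add _ (fun p => - w p) _ y q Y ny T 0 δ δ le_rfl hδ.le z2 hyc.1.2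
    (fun ξ => rfl) jy
  obtain ⟨n, σ, hσA, hσb, hσl⟩ := hA
  have I1 := visc_sub_jet _ _ A H T U v hsub x.fst hxc.1 x.snd hxc.2 Jx (σ x.snd) (hσA _)
  have I2 := visc_sup_jet _ _ A H T U w hsup y.fst hyc.1 y.snd hyc.2 Jy (σ y.snd) (hσA _)
  refine ⟨x.snd, y.snd, (p + penGrad d T θ δ δ z1 x).snd, -(q + penGrad d T 0 δ δ z2 y).snd, hxc.2, hyc.2, ?_, ?_, ?_, ?_, ?_⟩
  rotate_left 4
  · -- main inequality
    have T1 : θ / T ^ 2 ≤ θ / (T - x.fst) ^ 2 := by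
      have h1 := hxc.1.1
      have h2 := hxc.1.2
      apply div_le_div_of_nonneg_left hθ (by apply pow_pos; linarith)
      apply pow_le_pow_left₀ <;> linarith
    have F1 : ∀ (X : WithLp 2 (ℝ × Euc d) →L[ℝ] WithLp 2 (ℝ × Euc d)) (a b : ℝ)
        (M : Matrix (Fin d) (Fin n) ℝ),
        ∑ k, inner ℝ ((X + jD d a b) (jX d (mcol M k))) (jX d (mcol M k))
          = ∑ k, inner ℝ (X (jX d (mcol M k))) (jX d (mcol M k)) + b * ∑ k, ‖mcol M k‖ ^ 2 := by
      intro X a b M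
      rw [Finset.mul_sum, ← Finset.sum_add_distrib]
      refine Finset.sum_congr rfl fun k _ => ?_
      rw [_root_.add_apply, inner_add_left, jD_inner, jX_fst, jX_snd]
      ring
    have F2 : ∑ k, inner ℝ (X (jX d (mcol (σ x.snd) k))) (jX d (mcol (σ x.snd) k))
        + ∑ k, inner ℝ (Y (jX d (mcol (σ y.snd) k))) (jX d (mcol (σ y.snd) k))
        ≤ (2 / ε) * (L * ‖x.snd - y.snd‖) ^ 2 := by
      rw [← Finset.sum_add_distrib]
      calc _ ≤ ∑ k, (2 / ε) * ‖mcol (σ x.snd - σ y.snd) k‖ ^ 2 := by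
            refine Finset.sum_le_sum fun k _ => ?_
            refine (hXY _ _).trans_eq ?_
            rw [← map_sub, jX_norm, mcol_sub]
        _ ≤ _ := by
            rw [← Finset.mul_sum]
            exact mul_le_mul_of_nonneg_left (mcol_norm _ _ (hσl _ _)) (by positivity)
    have F3 := mcol_norm _ _ (hσb x.snd)
    have F4 := mcol_norm _ _ (hσb y.snd)
    have F5 := mul_le_mul_of_nonneg_left F3 (show 0 ≤ 3 * δ by positivity)
    have F6 := mul_le_mul_of_nonneg_left F4 (show 0 ≤ 3 * δ by positivity)
    rw [F1, WithLp.add_fst, penGrad_fst] at I1 I2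
    have G1 := (abs_le.mp (j_fst_le (p - (1 / ε) • (z1 - z2)))).1
    have G2 := (abs_le.mp (j_fst_le (q + (1 / ε) • (z1 - z2)))).1
    rw [WithLp.sub_fst] at G1
    rw [WithLp.add_fst] at G2
    have G3 := (abs_le.mp (j_fst_le (x - z1))).1
    have G4 := (abs_le.mp (j_fst_le (y - z2))).1
    rw [WithLp.sub_fst] at G3 G4
    have G5 := mul_le_mul_of_nonneg_left (show -τ ≤ x.fst - z1.fst by linarith)
      (show 0 ≤ 2 * δ by positivity)
    have G6 := mul_le_mul_of_nonneg_left (show -τ ≤ y.fst - z2.fst by linarith)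
      (show 0 ≤ 2 * δ by positivity)
    rw [zero_div] at I2
    linarith
  · exact (j_snd_le (x - z1)).trans_lt (by linarith)
  · exact (j_snd_le (y - z2)).trans_lt (by linarith)
  · have h1 := j_snd_le (p - (1 / ε) • (z1 - z2))
    have h2 := penGrad_snd_norm T θ δ δ hδ.le hδ.le z1 x
    have h3 := mul_le_mul_of_nonneg_left (show ‖x - z1‖ ≤ τ by linarith)
      (show 0 ≤ 2 * δ by positivity)
    have e : (p + penGrad d T θ δ δ z1 x).snd - (1 / ε) • (z1.snd - z2.snd)
        = (p - (1 / ε) • (z1 - z2)).snd + (penGrad d T θ δ δ z1 x).snd := by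
      simp only [WithLp.add_snd, WithLp.sub_snd, WithLp.smul_snd]; abel
    rw [e]
    refine (norm_add_le _ _).trans ?_
    linarith
  · have h1 := j_snd_le (q + (1 / ε) • (z1 - z2))
    have h2 := penGrad_snd_norm T 0 δ δ hδ.le hδ.le z2 y
    have h3 := mul_le_mul_of_nonneg_left (show ‖y - z2‖ ≤ τ by linarith)
      (show 0 ≤ 2 * δ by positivity)
    have e : -(q + penGrad d T 0 δ δ z2 y).snd - (1 / ε) • (z1.snd - z2.snd)
        = -((q + (1 / ε) • (z1 - z2)).snd + (penGrad d T 0 δ δ z2 y).snd) := by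
      simp only [WithLp.add_snd, WithLp.sub_snd, WithLp.smul_snd]; abel
    rw [e, norm_neg]
    refine (norm_add_le _ _).trans ?_
    linarith

end Key

section MaxEx

variable {d : ℕ}

/-- closed cylinder -/
def ccyl (d : ℕ) (T : ℝ) (U : Set (Euc d)) : Set (WithLp 2 (ℝ × Euc d)) :=
  {ξ | ξ.fst ∈ Icc (0 : ℝ) T ∧ ξ.snd ∈ closure U}

lemma cyl_sub (T : ℝ) (U : Set (Euc d)) : cyl d T U ⊆ ccyl d T U := fun _ h =>
  ⟨⟨h.1.1.le, h.1.2.le⟩, subset_closure h.2⟩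

lemma usc_lift (u : ℝ × Euc d → ℝ) (T : ℝ) (U : Set (Euc d))
    (hu : UpperSemicontinuousOn u (Icc 0 T ×ˢ closure U)) :
    UpperSemicontinuousOn (fun ξ : WithLp 2 (ℝ × Euc d) => u (ξ.fst, ξ.snd)) (ccyl d T U) := by
  intro ξ hξ r hr
  have hm : ∀ ζ ∈ ccyl d T U, (ζ.fst, ζ.snd) ∈ Icc (0 : ℝ) T ×ˢ closure U := fun ζ hζ => hζ
  have h2 := hu (ξ.fst, ξ.snd) (hm ξ hξ) r hr
  have hc : Continuous (fun ζ : WithLp 2 (ℝ × Euc d) => (ζ.fst, ζ.snd)) :=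
    j_cont_fst.prodMk j_cont_snd
  exact (hc.continuousWithinAt.tendsto_nhdsWithin hm).eventually h2

lemma growth_bound (u : ℝ × Euc d → ℝ) (T : ℝ) (U : Set (Euc d))
    (hu : UpperSemicontinuousOn u (Icc 0 T ×ˢ closure U)) (hg : SublinearAbove d T U u)
    (δ : ℝ) (hδ : 0 < δ) :
    ∃ C : ℝ, ∀ ξ ∈ cyl d T U, u (ξ.fst, ξ.snd) ≤ C + δ * ‖ξ.snd‖ := by
  obtain ⟨R, hR⟩ := hg δ hδ
  have hK : IsCompact (Icc 0 T ×ˢ (closure U ∩ closedBall (0 : Euc d) R)) :=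
    isCompact_Icc.prod ((isCompact_closedBall _ _).inter_left isClosed_closure)
  obtain ⟨C, hC⟩ : ∃ C, ∀ p ∈ Icc 0 T ×ˢ (closure U ∩ closedBall (0 : Euc d) R), u p ≤ C := by
    rcases (Icc 0 T ×ˢ (closure U ∩ closedBall (0 : Euc d) R)).eq_empty_or_nonempty with h | h
    · exact ⟨0, fun p hp => by rw [h] at hp; exact hp.elim⟩
    · obtain ⟨m, hm, hmax⟩ := (hu.mono (Set.prod_mono le_rfl inter_subset_left)).exists_isMaxOn h hK
      exact ⟨u m, fun p hp => hmax hp⟩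
  refine ⟨max C δ, fun ξ hξ => ?_⟩
  have hn := norm_nonneg ξ.snd
  by_cases h : ‖ξ.snd‖ ≤ R
  · have := hC (ξ.fst, ξ.snd) ⟨⟨hξ.1.1.le, hξ.1.2.le⟩, subset_closure hξ.2, by simpa using h⟩
    have h2 := le_max_left C δ
    have : 0 ≤ δ * ‖ξ.snd‖ := by positivity
    linarith
  · push Not at h
    have := hR ξ.snd hξ.2 h.le ξ.fst ⟨hξ.1.1.le, hξ.1.2.le⟩
    have h2 := le_max_right C δ
    linarith

lemma exists_max (T : ℝ) (U : Set (Euc d)) (hU : IsOpen U)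
    (v w : ℝ × Euc d → ℝ)
    (hv : UpperSemicontinuousOn v (Icc 0 T ×ˢ closure U))
    (hw : LowerSemicontinuousOn w (Icc 0 T ×ˢ closure U))
    (hgv : SublinearAbove d T U v) (hgw : SublinearBelow d T U w)
    (c : ℝ) (hc : ∀ p ∈ parabolicBoundary d T U, v p - w p ≤ c)
    (θ δ β ε1 : ℝ) (hθ : 0 < θ) (hδ : 0 < δ) (hβ : 0 < β) (hε1 : 0 < ε1)
    (zs : WithLp 2 (ℝ × Euc d)) (hzs : zs ∈ cyl d T U)
    (hstar : c + β ≤ v (zs.fst, zs.snd) - w (zs.fst, zs.snd) - θ / (T - zs.fst)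
      - δ * jb zs.snd - δ * jb zs.snd) :
    ∃ ε : ℝ, 0 < ε ∧ ε ≤ ε1 ∧ ∃ z1 ∈ cyl d T U, ∃ z2 ∈ cyl d T U,
      ∀ ξ1 ∈ cyl d T U, ∀ ξ2 ∈ cyl d T U,
      v (ξ1.fst, ξ1.snd) - w (ξ2.fst, ξ2.snd) - θ / (T - ξ1.fst) - δ * jb ξ1.snd - δ * jb ξ2.snd
        - ‖ξ1 - ξ2‖ ^ 2 / (2 * ε) ≤
      v (z1.fst, z1.snd) - w (z2.fst, z2.snd) - θ / (T - z1.fst) - δ * jb z1.snd - δ * jb z2.snd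
        - ‖z1 - z2‖ ^ 2 / (2 * ε) := by
  have hnw : UpperSemicontinuousOn (fun p => - w p) (Icc 0 T ×ˢ closure U) := hw.neg
  have hgw' : SublinearAbove d T U (fun p => - w p) := by
    intro e he
    obtain ⟨R, hR⟩ := hgw e he
    exact ⟨R, fun x hx hxR t ht => by have := hR x hx hxR t ht; linarith⟩
  obtain ⟨C1, hC1⟩ := growth_bound v T U hv hgv (δ / 2) (by positivity)
  obtain ⟨C2, hC2⟩ := growth_bound _ T U hnw hgw' (δ / 2) (by positivity)
  have hV := usc_lift v T U hv
  have hW := usc_lift _ T U hnw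
  obtain ⟨V, hVd⟩ : ∃ V : WithLp 2 (ℝ × Euc d) → ℝ, ∀ ξ, v (ξ.fst, ξ.snd) = V ξ := ⟨_, fun _ => rfl⟩
  obtain ⟨W, hWd⟩ : ∃ W : WithLp 2 (ℝ × Euc d) → ℝ, ∀ ξ, w (ξ.fst, ξ.snd) = W ξ := ⟨_, fun _ => rfl⟩
  simp only [hVd, hWd] at hstar hC1 hC2 hV hW ⊢
  obtain ⟨M, hM⟩ : ∃ M, M = C1 + C2 - (c + β) := ⟨_, rfl⟩
  -- bounds from being above the level
  have hbd : ∀ ε : ℝ, 0 < ε → ∀ ξ1 ∈ cyl d T U, ∀ ξ2 ∈ cyl d T U,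
      c + β ≤ V ξ1 - W ξ2 - θ / (T - ξ1.fst) - δ * jb ξ1.snd - δ * jb ξ2.snd
        - ‖ξ1 - ξ2‖ ^ 2 / (2 * ε) →
      ‖ξ1.snd‖ ≤ 2 * M / δ ∧ ‖ξ2.snd‖ ≤ 2 * M / δ ∧ θ / (T - ξ1.fst) ≤ M ∧
        ‖ξ1 - ξ2‖ ^ 2 / (2 * ε) ≤ M := by
    intro ε hε ξ1 h1 ξ2 h2 h
    have a1 := hC1 ξ1 h1
    have a2 := hC2 ξ2 h2
    have a3 := mul_le_mul_of_nonneg_left (jb_ge_norm ξ1.snd) hδ.le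
    have a4 := mul_le_mul_of_nonneg_left (jb_ge_norm ξ2.snd) hδ.le
    have a5 : 0 ≤ θ / (T - ξ1.fst) := by
      have := h1.1.2
      have : 0 < T - ξ1.fst := by linarith
      positivity
    have a6 : 0 ≤ ‖ξ1 - ξ2‖ ^ 2 / (2 * ε) := by positivity
    have a7 : 0 ≤ δ * ‖ξ1.snd‖ := by positivity
    have a8 : 0 ≤ δ * ‖ξ2.snd‖ := by positivity
    refine ⟨?_, ?_, ?_, ?_⟩
    · rw [le_div_iff₀ hδ]; linarith
    · rw [le_div_iff₀ hδ]; linarith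
    · linarith
    · linarith
  have hTs : 0 < T - zs.fst := by have := hzs.1.2; linarith
  have hMpos : 0 < M := by
    have := (hbd 1 one_pos zs hzs zs hzs (by simpa using hstar)).2.2.1
    exact lt_of_lt_of_le (by positivity) this
  -- `t`-closeness is needed for the second point as well
  obtain ⟨K, hKd⟩ : ∃ K : Set (WithLp 2 (ℝ × Euc d)), K = {ξ | 0 ≤ ξ.fst ∧ θ ≤ 2 * M * (T - ξ.fst) ∧
      ξ.snd ∈ closure U ∧ ‖ξ.snd‖ ≤ 2 * M / δ} := ⟨_, rfl⟩
  have cf := j_cont_fst (d := d)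
  have cs := j_cont_snd (d := d)
  have hKlt : ∀ ξ ∈ K, ξ.fst < T := by
    intro ξ hξ
    rw [hKd] at hξ
    have h1 : 0 < 2 * M * (T - ξ.fst) := lt_of_lt_of_le hθ hξ.2.1
    have h2 : 0 < T - ξ.fst := (mul_pos_iff_of_pos_left (by positivity)).mp h1
    linarith
  have hKc : K ⊆ ccyl d T U := by
    intro ξ hξ
    have := hKlt ξ hξ
    rw [hKd] at hξ
    exact ⟨⟨hξ.1, this.le⟩, hξ.2.2.1⟩
  have hKclosed : IsClosed K := by
    rw [hKd]
    refine (isClosed_le continuous_const cf).inter ?_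
    have c4 : Continuous (fun ξ : WithLp 2 (ℝ × Euc d) => 2 * M * (T - ξ.fst)) :=
      continuous_const.mul (continuous_const.sub cf)
    refine (isClosed_le continuous_const c4).inter ?_
    exact (isClosed_closure.preimage cs).inter (isClosed_le cs.norm continuous_const)
  have hKcomp : IsCompact K := by
    refine Metric.isCompact_of_isClosed_isBounded hKclosed ?_
    refine (Metric.isBounded_closedBall (x := (0 : WithLp 2 (ℝ × Euc d)))
      (r := T + 2 * M / δ)).subset ?_
    intro ξ hξ
    have h1 := hKlt ξ hξ
    rw [hKd] at hξ
    rw [mem_closedBall, dist_zero_right]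
    have h2 := hξ.1
    have h3 := hξ.2.2.2
    have h4 : 0 ≤ 2 * M / δ := by positivity
    have hn := WithLp.prod_norm_sq_eq_of_L2 ξ
    rw [Real.norm_eq_abs, sq_abs] at hn
    apply le_of_sq_le_sq _ (by linarith)
    rw [hn]
    have h5 := norm_nonneg ξ.snd
    nlinarith
  have hop := cyl_open T U hU
  -- good open sets
  obtain ⟨r, hr, hleb⟩ := lebesgue_number_lemma_of_metric
    (s := K \ cyl d T U)
    (c := fun O : {O : Set (WithLp 2 (ℝ × Euc d)) // IsOpen O ∧
      ∀ ξ1 ∈ O, ∀ ξ2 ∈ O, ξ1 ∈ ccyl d T U → ξ2 ∈ ccyl d T U → V ξ1 - W ξ2 < c + β} => O.1)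
    (hKcomp.diff hop) (fun O => O.2.1) (by
      intro z hz
      have hzc := hKc hz.1
      have hzT := hKlt z hz.1
      have hzb : (z.fst, z.snd) ∈ parabolicBoundary d T U := by
        by_cases h : z.snd ∈ U
        · left
          refine ⟨?_, h⟩
          by_contra h0
          apply hz.2
          exact ⟨⟨lt_of_le_of_ne hzc.1.1 (Ne.symm h0), hzT⟩, h⟩
        · right
          refine ⟨⟨hzc.1.1, hzT⟩, ?_⟩
          rw [hU.frontier_eq]
          exact ⟨hzc.2, h⟩
      have hcz := hc _ hzb
      rw [hVd, hWd] at hcz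
      have e1 := hV z hzc (V z + β / 2) (by linarith)
      have e2 := hW z hzc (- W z + β / 2) (by linarith)
      rw [eventually_nhdsWithin_iff] at e1 e2
      obtain ⟨O, hO, hOo, hzO⟩ := _root_.mem_nhds_iff.mp (e1.and e2)
      refine mem_iUnion.mpr ⟨⟨O, hOo, fun ξ1 h1 ξ2 h2 c1 c2 => ?_⟩, hzO⟩
      have f1 := (hO h1).1 c1
      have f2 := (hO h2).2 c2
      linarith)
  -- choose ε
  obtain ⟨ε, hεd⟩ : ∃ ε, ε = min ε1 (min (r ^ 2 / (16 * M)) ((θ / (2 * M)) ^ 2 / (2 * M))) := ⟨_, rfl⟩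
  have hε : 0 < ε := by rw [hεd]; positivity
  have hε2 : ε ≤ r ^ 2 / (16 * M) := by
    rw [hεd]; exact (min_le_right _ _).trans (min_le_left _ _)
  have hε3 : ε ≤ (θ / (2 * M)) ^ 2 / (2 * M) := by
    rw [hεd]; exact (min_le_right _ _).trans (min_le_right _ _)
  rw [le_div_iff₀ (by positivity)] at hε2 hε3
  obtain ⟨K', hK'⟩ : ∃ K' : Set (WithLp 2 (ℝ × Euc d)), K' = K ∩
    {ξ | ∀ z ∈ K \ cyl d T U, r / 2 ≤ dist ξ z} := ⟨_, rfl⟩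
  have hK'cyl : K' ⊆ cyl d T U := by
    intro ξ hξ
    rw [hK'] at hξ
    by_contra h
    have := hξ.2 ξ ⟨hξ.1, h⟩
    rw [dist_self] at this
    linarith
  have hK'comp : IsCompact K' := by
    rw [hK']
    refine hKcomp.inter_right ?_
    have : {ξ | ∀ z ∈ K \ cyl d T U, r / 2 ≤ dist ξ z}
        = ⋂ z ∈ K \ cyl d T U, {ξ | r / 2 ≤ dist ξ z} := by ext; simp
    rw [this]
    exact isClosed_biInter fun z _ => isClosed_le continuous_const (by fun_prop)
  have hlev : ∀ ξ1 ∈ cyl d T U, ∀ ξ2 ∈ cyl d T U,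
      c + β ≤ V ξ1 - W ξ2 - θ / (T - ξ1.fst) - δ * jb ξ1.snd - δ * jb ξ2.snd
        - ‖ξ1 - ξ2‖ ^ 2 / (2 * ε) → ξ1 ∈ K' ∧ ξ2 ∈ K' := by
    intro ξ1 h1 ξ2 h2 h
    obtain ⟨b1, b2, b3, b4⟩ := hbd ε hε ξ1 h1 ξ2 h2 h
    have hT1 : 0 < T - ξ1.fst := by have := h1.1.2; linarith
    rw [div_le_iff₀ hT1] at b3
    rw [div_le_iff₀ (by positivity)] at b4
    have hd : ‖ξ1 - ξ2‖ < r / 2 := by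
      apply lt_of_pow_lt_pow_left₀ 2 (by positivity)
      nlinarith
    have hd2 : ‖ξ1 - ξ2‖ ≤ θ / (2 * M) := by
      apply le_of_sq_le_sq _ (by positivity)
      nlinarith
    have hs := (abs_le.mp (j_fst_le (ξ1 - ξ2))).1
    rw [WithLp.sub_fst] at hs
    rw [le_div_iff₀ (by positivity)] at hd2
    have hk1 : ξ1 ∈ K := by
      rw [hKd]
      refine ⟨h1.1.1.le, ?_, subset_closure h1.2, b1⟩
      nlinarith
    have hk2 : ξ2 ∈ K := by
      rw [hKd]
      refine ⟨h2.1.1.le, ?_, subset_closure h2.2, b2⟩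
      nlinarith
    have hbad : V ξ1 - W ξ2 ≥ c + β := by
      have a3 := mul_nonneg hδ.le (zero_le_one.trans (jb_ge_one ξ1.snd))
      have a4 := mul_nonneg hδ.le (zero_le_one.trans (jb_ge_one ξ2.snd))
      have a5 : 0 ≤ θ / (T - ξ1.fst) := by positivity
      have a6 : 0 ≤ ‖ξ1 - ξ2‖ ^ 2 / (2 * ε) := by positivity
      linarith
    have hfar : ∀ z ∈ K \ cyl d T U, ¬ (dist ξ1 z < r ∧ dist ξ2 z < r) := by
      rintro z hz ⟨g1, g2⟩
      obtain ⟨O, hO⟩ := hleb z hz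
      have := O.2.2 ξ1 (hO g1) ξ2 (hO g2) (cyl_sub T U h1) (cyl_sub T U h2)
      linarith
    rw [← dist_eq_norm] at hd
    rw [hK']
    refine ⟨⟨hk1, fun z hz => ?_⟩, ⟨hk2, fun z hz => ?_⟩⟩
    · by_contra hcon
      push Not at hcon
      refine hfar z hz ⟨by linarith, ?_⟩
      have := dist_triangle_left ξ2 z ξ1
      linarith
    · by_contra hcon
      push Not at hcon
      refine hfar z hz ⟨?_, by linarith⟩
      have := dist_triangle ξ1 ξ2 z
      linarith
  have hsl : c + β ≤ V zs - W zs - θ / (T - zs.fst) - δ * jb zs.snd - δ * jb zs.snd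
        - ‖zs - zs‖ ^ 2 / (2 * ε) := by simpa using hstar
  have hzsK := (hlev zs hzs zs hzs hsl).1
  have husc : UpperSemicontinuousOn (fun z : WithLp 2 (ℝ × Euc d) × WithLp 2 (ℝ × Euc d) =>
      (V z.1 + - W z.2) + (- (θ / (T - z.1.fst)) - δ * jb z.1.snd - δ * jb z.2.snd
        - ‖z.1 - z.2‖ ^ 2 / (2 * ε))) (K' ×ˢ K') := by
    apply UpperSemicontinuousOn.add
    · apply UpperSemicontinuousOn.add
      · intro z hz s hs
        have h1 := (hV.mono ((hK'cyl).trans (cyl_sub T U))) z.1 hz.1 s hs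
        exact (continuous_fst.continuousWithinAt.tendsto_nhdsWithin
          (fun y hy => hy.1 : MapsTo Prod.fst (K' ×ˢ K') K')).eventually h1
      · intro z hz s hs
        have h1 := (hW.mono ((hK'cyl).trans (cyl_sub T U))) z.2 hz.2 s hs
        exact (continuous_snd.continuousWithinAt.tendsto_nhdsWithin
          (fun y hy => hy.2 : MapsTo Prod.snd (K' ×ˢ K') K')).eventually h1
    · apply ContinuousOn.upperSemicontinuousOn
      have cj := jb_cont (d := d)
      have c1 : Continuous (fun z : WithLp 2 (ℝ × Euc d) × WithLp 2 (ℝ × Euc d) => jb z.1.snd) :=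
        cj.comp (cs.comp continuous_fst)
      have c2 : Continuous (fun z : WithLp 2 (ℝ × Euc d) × WithLp 2 (ℝ × Euc d) => jb z.2.snd) :=
        cj.comp (cs.comp continuous_snd)
      have c3 : Continuous (fun z : WithLp 2 (ℝ × Euc d) × WithLp 2 (ℝ × Euc d) => z.1.fst) :=
        cf.comp continuous_fst
      refine ContinuousOn.sub (ContinuousOn.sub (ContinuousOn.sub (ContinuousOn.neg ?_)
        (by fun_prop)) (by fun_prop)) (by fun_prop)
      refine ContinuousOn.div continuousOn_const (by fun_prop) ?_
      intro z hz
      have := (hK'cyl hz.1).1.2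
      linarith
  obtain ⟨⟨z1, z2⟩, hz, hmax⟩ := husc.exists_isMaxOn
    (show (K' ×ˢ K').Nonempty from ⟨(zs, zs), hzsK, hzsK⟩) (hK'comp.prod hK'comp)
  refine ⟨ε, hε, by rw [hεd]; exact min_le_left _ _, z1, hK'cyl hz.1, z2, hK'cyl hz.2, ?_⟩
  have hmax2 : ∀ ξ1 ∈ K', ∀ ξ2 ∈ K',
      V ξ1 - W ξ2 - θ / (T - ξ1.fst) - δ * jb ξ1.snd - δ * jb ξ2.snd
        - ‖ξ1 - ξ2‖ ^ 2 / (2 * ε) ≤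
      V z1 - W z2 - θ / (T - z1.fst) - δ * jb z1.snd - δ * jb z2.snd
        - ‖z1 - z2‖ ^ 2 / (2 * ε) := by
    intro ξ1 h1 ξ2 h2
    have := hmax (show (ξ1, ξ2) ∈ K' ×ˢ K' from ⟨h1, h2⟩)
    simp only [mem_ofPred_eq] at this
    linarith
  intro ξ1 h1 ξ2 h2
  by_cases h : c + β ≤ V ξ1 - W ξ2 - θ / (T - ξ1.fst) - δ * jb ξ1.snd - δ * jb ξ2.snd
        - ‖ξ1 - ξ2‖ ^ 2 / (2 * ε)
  · obtain ⟨k1, k2⟩ := hlev ξ1 h1 ξ2 h2 h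
    exact hmax2 ξ1 k1 ξ2 k2
  · push Not at h
    exact h.le.trans (hsl.trans (hmax2 zs hzsK zs hzsK))

end MaxEx

section Final

variable {d : ℕ}

lemma lip_close (T : ℝ) (U : Set (Euc d)) (v w : ℝ × Euc d → ℝ) (κ : ℝ)
    (hLip :
      (∀ t ∈ Ioo (0 : ℝ) T, ∀ x ∈ U, ∀ y ∈ U, |v (t, x) - v (t, y)| ≤ κ * ‖x - y‖) ∨
      (∀ t ∈ Ioo (0 : ℝ) T, ∀ x ∈ U, ∀ y ∈ U, |w (t, x) - w (t, y)| ≤ κ * ‖x - y‖))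
    (hκ : 0 ≤ κ)
    (θ δ ε : ℝ) (hδ : 0 < δ) (hε : 0 < ε)
    (z1 z2 : WithLp 2 (ℝ × Euc d)) (hz1 : z1 ∈ cyl d T U) (hz2 : z2 ∈ cyl d T U)
    (hmax : ∀ ξ1 ∈ cyl d T U, ∀ ξ2 ∈ cyl d T U,
      v (ξ1.fst, ξ1.snd) - w (ξ2.fst, ξ2.snd) - θ / (T - ξ1.fst) - δ * jb ξ1.snd - δ * jb ξ2.snd
        - ‖ξ1 - ξ2‖ ^ 2 / (2 * ε) ≤
      v (z1.fst, z1.snd) - w (z2.fst, z2.snd) - θ / (T - z1.fst) - δ * jb z1.snd - δ * jb z2.snd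
        - ‖z1 - z2‖ ^ 2 / (2 * ε)) :
    ‖z1.snd - z2.snd‖ ≤ 2 * ε * (κ + δ) := by
  have n0 := norm_nonneg (z1.snd - z2.snd)
  have hn := WithLp.prod_norm_sq_eq_of_L2 (z1 - z2)
  rw [WithLp.sub_fst, WithLp.sub_snd] at hn
  have key : ‖z1.snd - z2.snd‖ ^ 2 / (2 * ε) ≤ (κ + δ) * ‖z1.snd - z2.snd‖ := by
    rcases hLip with h | h
    · have h1 := hmax (WithLp.toLp 2 (z1.fst, z2.snd)) ⟨hz1.1, hz2.2⟩ z2 hz2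
      have hn2 := WithLp.prod_norm_sq_eq_of_L2 (WithLp.toLp 2 (z1.fst, z2.snd) - z2)
      rw [WithLp.sub_fst, WithLp.sub_snd] at hn2
      simp only [WithLp.toLp_fst, WithLp.toLp_snd, sub_self, norm_zero] at h1 hn2
      rw [hn, hn2, add_div] at h1
      have h2 := (abs_le.mp (h _ hz1.1 _ hz1.2 _ hz2.2)).2
      have h3 := mul_le_mul_of_nonneg_left (jb_lip z2.snd z1.snd) hδ.le
      rw [norm_sub_rev z2.snd] at h3
      ring_nf at h1 h2 h3 ⊢
      linarith
    · have h1 := hmax z1 hz1 (WithLp.toLp 2 (z2.fst, z1.snd)) ⟨hz2.1, hz1.2⟩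
      have hn2 := WithLp.prod_norm_sq_eq_of_L2 (z1 - WithLp.toLp 2 (z2.fst, z1.snd))
      rw [WithLp.sub_fst, WithLp.sub_snd] at hn2
      simp only [WithLp.toLp_fst, WithLp.toLp_snd, sub_self, norm_zero] at h1 hn2
      rw [hn, hn2, add_div] at h1
      have h2 := (abs_le.mp (h _ hz2.1 _ hz1.2 _ hz2.2)).2
      have h3 := mul_le_mul_of_nonneg_left (jb_lip z1.snd z2.snd) hδ.le
      ring_nf at h1 h2 h3 ⊢
      linarith
  rw [div_le_iff₀ (by positivity)] at key
  by_contra hcon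
  push Not at hcon
  have : 0 < 2 * ε * (κ + δ) := by positivity
  nlinarith

set_option maxHeartbeats 1000000 in
lemma comparison (T : ℝ) (hT : 0 < T)
    (U : Set (Euc d)) (hU : IsOpen U)
    (L : ℝ) (A : Euc d → Matrix (Fin d) (Fin d) ℝ) (hA : CondA d L A)
    (H : Euc d → Euc d → ℝ)
    (hH : ∀ r : ℝ, 0 < r →
      UniformContinuousOn (fun q : Euc d × Euc d => H q.1 q.2) (U ×ˢ ball (0 : Euc d) r))
    (v w : ℝ × Euc d → ℝ)
    (hv : UpperSemicontinuousOn v (Icc 0 T ×ˢ closure U))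
    (hw : LowerSemicontinuousOn w (Icc 0 T ×ˢ closure U))
    (hsub : IsViscSubsolution d A H T U v)
    (hsup : IsViscSupersolution d A H T U w)
    (hgv : SublinearAbove d T U v) (hgw : SublinearBelow d T U w)
    (κ : ℝ) (hκ : 0 ≤ κ)
    (hLip :
      (∀ t ∈ Ioo (0 : ℝ) T, ∀ x ∈ U, ∀ y ∈ U, |v (t, x) - v (t, y)| ≤ κ * ‖x - y‖) ∨
      (∀ t ∈ Ioo (0 : ℝ) T, ∀ x ∈ U, ∀ y ∈ U, |w (t, x) - w (t, y)| ≤ κ * ‖x - y‖))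
    (c : ℝ) (hc : ∀ p ∈ parabolicBoundary d T U, v p - w p ≤ c)
    (t : ℝ) (ht : t ∈ Ioo (0 : ℝ) T) (x : Euc d) (hx : x ∈ U) : v (t, x) - w (t, x) ≤ c := by
  by_contra hcon
  push Not at hcon
  obtain ⟨g, hg⟩ : ∃ g, g = v (t, x) - w (t, x) - c := ⟨_, rfl⟩
  have hg0 : 0 < g := by linarith
  have hTt : 0 < T - t := by have := ht.2; linarith
  obtain ⟨θ, hθ⟩ : ∃ θ, θ = g * (T - t) / 4 := ⟨_, rfl⟩
  have hθ0 : 0 < θ := by rw [hθ]; positivity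
  have hθt : θ / (T - t) = g / 4 := by rw [hθ]; field_simp
  obtain ⟨ρ, hρ⟩ : ∃ ρ, ρ = θ / T ^ 2 := ⟨_, rfl⟩
  have hρ0 : 0 < ρ := by rw [hρ]; positivity
  obtain ⟨ω, hω, hmod⟩ := Metric.uniformContinuousOn_iff.mp (hH (2 * κ + 10) (by positivity))
    (ρ / 4) (by positivity)
  have hj := jb_ge_one x
  obtain ⟨δ, hδd⟩ : ∃ δ, δ = min 1 (min (ω / 12) (min (g / (8 * jb x)) (ρ / (64 * (L ^ 2 + 1))))) :=
    ⟨_, rfl⟩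
  have hδ : 0 < δ := by rw [hδd]; positivity
  have hδ1 : δ ≤ 1 := by rw [hδd]; exact min_le_left _ _
  have hδ2 : δ ≤ ω / 12 := by rw [hδd]; exact (min_le_right _ _).trans (min_le_left _ _)
  have hδ3 : δ ≤ g / (8 * jb x) := by
    rw [hδd]; exact (min_le_right _ _).trans ((min_le_right _ _).trans (min_le_left _ _))
  have hδ4 : δ ≤ ρ / (64 * (L ^ 2 + 1)) := by
    rw [hδd]; exact (min_le_right _ _).trans ((min_le_right _ _).trans (min_le_right _ _))
  rw [le_div_iff₀ (by positivity)] at hδ3 hδ4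
  obtain ⟨ε1, hεdef⟩ : ∃ ε1, ε1 = min (ω / (4 * (κ + 2))) (ρ / (64 * (L ^ 2 + 1) * (κ + 2) ^ 2)) :=
    ⟨_, rfl⟩
  have hε1 : 0 < ε1 := by rw [hεdef]; positivity
  obtain ⟨ε, hε, hεε, z1, hz1, z2, hz2, hmax⟩ := exists_max T U hU v w hv hw hgv hgw c hc θ δ (g / 4)
    ε1 hθ0 hδ (by positivity) hε1 (WithLp.toLp 2 (t, x)) ⟨ht, hx⟩ (by
      simp only [WithLp.toLp_fst, WithLp.toLp_snd]
      rw [hθt]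
      linarith)
  have hεa : ε ≤ ω / (4 * (κ + 2)) := hεε.trans (by rw [hεdef]; exact min_le_left _ _)
  have hεb : ε ≤ ρ / (64 * (L ^ 2 + 1) * (κ + 2) ^ 2) :=
    hεε.trans (by rw [hεdef]; exact min_le_right _ _)
  rw [le_div_iff₀ (by positivity)] at hεa hεb
  have hcl := lip_close T U v w κ hLip hκ θ δ ε hδ hε z1 z2 hz1 hz2 hmax
  obtain ⟨τ, hτd⟩ : ∃ τ, τ = min ε (min δ (ρ / 64)) := ⟨_, rfl⟩
  have hτ : 0 < τ := by rw [hτd]; positivity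
  have hτ1 : τ ≤ ε := by rw [hτd]; exact min_le_left _ _
  have hτ2 : τ ≤ δ := by rw [hτd]; exact (min_le_right _ _).trans (min_le_left _ _)
  have hτ3 : τ ≤ ρ / 64 := by rw [hτd]; exact (min_le_right _ _).trans (min_le_right _ _)
  obtain ⟨a, b, ga, gb, ha, hb, haz, hbz, hga, hgb, hfin⟩ := key_ineq T U hU L A hA H v w hv hw
    hsub hsup θ δ ε τ hθ0.le hδ hε hτ z1 z2 hz1 hz2 hmax
  rw [← hρ] at hfin
  have hδτ : δ * τ ≤ τ := mul_le_of_le_one_left hτ.le hδ1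
  have hab : ‖a - b‖ ≤ 2 * ε * (κ + 2) := by
    have e : a - b = (a - z1.snd) + (z1.snd - z2.snd) - (b - z2.snd) := by abel
    have h1 : ‖a - b‖ ≤ ‖a - z1.snd‖ + ‖z1.snd - z2.snd‖ + ‖b - z2.snd‖ := by
      rw [e]
      exact (norm_sub_le _ _).trans (add_le_add_left (norm_add_le _ _) _)
    have h2 : ε * δ ≤ ε := mul_le_of_le_one_right hε.le hδ1
    linarith
  have hP : ‖(1 / ε) • (z1.snd - z2.snd)‖ ≤ 2 * (κ + δ) := by
    rw [norm_smul, Real.norm_of_nonneg (by positivity), one_div, inv_mul_le_iff₀ hε]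
    linarith
  have hgan : ‖ga‖ < 2 * κ + 10 := by
    have h := norm_le_norm_add_norm_sub' ga ((1 / ε) • (z1.snd - z2.snd))
    linarith
  have hgbn : ‖gb‖ < 2 * κ + 10 := by
    have h := norm_le_norm_add_norm_sub' gb ((1 / ε) • (z1.snd - z2.snd))
    linarith
  have hgd : ‖gb - ga‖ < ω := by
    have e : gb - ga = (gb - (1 / ε) • (z1.snd - z2.snd)) - (ga - (1 / ε) • (z1.snd - z2.snd)) := by
      abel
    have h := norm_sub_le (gb - (1 / ε) • (z1.snd - z2.snd)) (ga - (1 / ε) • (z1.snd - z2.snd))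
    rw [← e] at h
    linarith
  have hHd := hmod (b, gb) ⟨hb, by simpa using hgbn⟩ (a, ga) ⟨ha, by simpa using hgan⟩ (by
    rw [Prod.dist_eq]
    refine max_lt ?_ ?_
    · rw [dist_eq_norm, norm_sub_rev]
      show ‖a - b‖ < ω
      linarith
    · rw [dist_eq_norm]; exact hgd)
  rw [Real.dist_eq] at hHd
  have hH1 := (abs_lt.mp hHd).2
  simp only at hH1
  have hq : (2 / ε) * (L * ‖a - b‖) ^ 2 ≤ ρ / 8 := by
    have h1 : ‖a - b‖ ^ 2 ≤ (2 * ε * (κ + 2)) ^ 2 := pow_le_pow_left₀ (norm_nonneg _) hab 2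
    calc (2 / ε) * (L * ‖a - b‖) ^ 2 = (2 / ε) * L ^ 2 * ‖a - b‖ ^ 2 := by ring
      _ ≤ (2 / ε) * L ^ 2 * (2 * ε * (κ + 2)) ^ 2 := by gcongr
      _ = 8 * (ε * (L ^ 2 * (κ + 2) ^ 2)) := by field_simp; ring
      _ ≤ ρ / 8 := by
        have : 0 ≤ ε * (κ + 2) ^ 2 := by positivity
        linarith
  have hd4 : 6 * δ * L ^ 2 ≤ ρ / 8 := by
    linarith
  linarith

end Final

/-- **Comparison principle under a Lipschitz side condition** (Proposition
`prop Lip comp`): if `H` is uniformly continuous on `U × B_r` for every `r > 0`, `v` and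
`w` are semicontinuous viscosity sub/supersolutions with sublinear growth, and one of them
is Lipschitz in the space variable uniformly in time, then `v - w` is bounded inside the
cylinder by its supremum on the parabolic boundary. -/
theorem statement3 (d : ℕ) (hd : 0 < d) (T : ℝ) (hT : 0 < T)
    (U : Set (Euc d)) (hU : IsOpen U)
    (ΛA : ℝ) (hΛA : 0 < ΛA) (A : Euc d → Matrix (Fin d) (Fin d) ℝ) (hA : CondA d ΛA A)
    (H : Euc d → Euc d → ℝ)
    (hH : ∀ r : ℝ, 0 < r →
      UniformContinuousOn (fun q : Euc d × Euc d => H q.1 q.2) (U ×ˢ ball (0 : Euc d) r))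
    (v w : ℝ × Euc d → ℝ)
    (hv : UpperSemicontinuousOn v (Icc 0 T ×ˢ closure U))
    (hw : LowerSemicontinuousOn w (Icc 0 T ×ˢ closure U))
    (hsub : IsViscSubsolution d A H T U v)
    (hsup : IsViscSupersolution d A H T U w)
    (hgv : SublinearAbove d T U v) (hgw : SublinearBelow d T U w)
    (hLip :
      (∃ κ : ℝ, 0 ≤ κ ∧ ∀ t ∈ Ioo (0 : ℝ) T, ∀ x ∈ U, ∀ y ∈ U,
        |v (t, x) - v (t, y)| ≤ κ * ‖x - y‖) ∨
      (∃ κ : ℝ, 0 ≤ κ ∧ ∀ t ∈ Ioo (0 : ℝ) T, ∀ x ∈ U, ∀ y ∈ U,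
        |w (t, x) - w (t, y)| ≤ κ * ‖x - y‖))
    (c : ℝ) (hc : ∀ p ∈ parabolicBoundary d T U, v p - w p ≤ c) :
    ∀ t ∈ Ioo (0 : ℝ) T, ∀ x ∈ U, v (t, x) - w (t, x) ≤ c := by
  rcases hLip with ⟨κ, hκ, h⟩ | ⟨κ, hκ, h⟩
  · exact fun t ht x hx => comparison T hT U hU ΛA A hA H hH v w hv hw hsub hsup hgv hgw κ hκ
      (Or.inl h) c hc t ht x hx
  · exact fun t ht x hx => comparison T hT U hU ΛA A hA H hH v w hv hw hsub hsup hgv hgw κ hκ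
      (Or.inr h) c hc t ht x hx
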